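/- arXiv:1108.5313 — 2 statements merged into one kernel-verified Lean document; each statement's English description precedes it below -/
import Mathlib

section
/- Suppose (Ω₁,u₁),…,(Ω_k,u_k) is a family of disjointly supported minimal graphs in ℝ³ (pairwise disjoint open sets Ω_i ⊆ ℝ², each u_i a nonnegative, not identically zero smooth solution of the minimal surface equation vanishing continuously on ∂Ω_i). If each graph has sub-linear growth, i.e. u_i(x)/|x| → 0 as |x| → ∞ in Ω_i, then k ≤ 2. -/
open Real MeasureTheory ENNReal

noncomputable section

abbrev E2 := EuclideanSpace ℝ (Fin 2)

/-- The divergence of the vector field `∇u/√(1+|∇u|²)` at the point `x`;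
the minimal surface equation asserts that this vanishes. -/
def msDiv (u : E2 → ℝ) (x : E2) : ℝ :=
  ∑ i : Fin 2, fderiv ℝ (fun y => (Real.sqrt (1 + ‖gradient u y‖ ^ 2))⁻¹ * gradient u y i) x
    (EuclideanSpace.single i 1)

/-! ### One-variable inequalities -/

/-- Cauchy–Schwarz for interval integrals, in the form `m² ≤ pq ⟹ (∫m)² ≤ ∫p ∫q`. -/
theorem sq_intervalIntegral_le {a b : ℝ} (hab : a ≤ b) {m p q : ℝ → ℝ} (hm : Continuous m)
    (hp : Continuous p) (hq : Continuous q) (hp0 : ∀ x, 0 ≤ p x) (hq0 : ∀ x, 0 ≤ q x)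
    (h : ∀ x, m x ^ 2 ≤ p x * q x) :
    (∫ x in a..b, m x) ^ 2 ≤ (∫ x in a..b, p x) * ∫ x in a..b, q x := by
  have key : ∀ t : ℝ, 0 ≤ (∫ x in a..b, p x) * (t * t) + (2 * ∫ x in a..b, m x) * t +
      ∫ x in a..b, q x := by
    intro t
    have hpt : ∀ x, 0 ≤ p x * (t * t) + 2 * m x * t + q x := by
      intro x
      rcases (hp0 x).eq_or_lt with h0 | h0
      · have : m x = 0 := by
          have := h x
          rw [← h0, zero_mul] at this
          exact pow_eq_zero_iff (two_ne_zero) |>.1 (le_antisymm this (sq_nonneg _))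
        rw [← h0, this]
        simpa using hq0 x
      · have : 0 ≤ p x * (p x * (t * t) + 2 * m x * t + q x) := by
          nlinarith [sq_nonneg (p x * t + m x), h x]
        exact nonneg_of_mul_nonneg_right this h0
    have hint := intervalIntegral.integral_nonneg (μ := volume) hab fun x _ => hpt x
    have e : (∫ x in a..b, p x * (t * t) + 2 * m x * t + q x) =
        (∫ x in a..b, p x) * (t * t) + (2 * ∫ x in a..b, m x) * t + ∫ x in a..b, q x := by
      rw [intervalIntegral.integral_add, intervalIntegral.integral_add,
        intervalIntegral.integral_mul_const, intervalIntegral.integral_mul_const,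
        intervalIntegral.integral_const_mul]
      all_goals exact Continuous.intervalIntegrable (by fun_prop) _ _
    rwa [e] at hint
  have := discrim_le_zero key
  unfold discrim at this
  nlinarith

/-- A weighted Wirtinger inequality with a non-sharp constant. -/
theorem intervalIntegral_sq_mul_le_of_deriv_sq_le {a b : ℝ} (hab : a ≤ b) {f f' e g : ℝ → ℝ}
    (hf : ∀ x, HasDerivAt f (f' x) x) (hf' : Continuous f') (he : Continuous e)
    (hg : Continuous g) (he0 : ∀ x, 0 ≤ e x) (hg0 : ∀ x, 0 ≤ g x)
    (h : ∀ x, f' x ^ 2 ≤ e x * g x) (hfa : f a = 0) (hfb : f b = 0) :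
    6 * (∫ x in a..b, f x ^ 2 * g x) ≤ (∫ x in a..b, e x) * (∫ x in a..b, g x) ^ 2 := by
  set S : ℝ → ℝ := fun x => ∫ y in a..x, g y with hS
  set L := S b with hL
  set E := ∫ x in a..b, e x with hE
  have hfc : Continuous f := continuous_iff_continuousAt.2 fun x => (hf x).continuousAt
  have hSd : ∀ x, HasDerivAt S (g x) x := fun x =>
    intervalIntegral.integral_hasDerivAt_right (hg.intervalIntegrable _ _)
      (hg.stronglyMeasurableAtFilter _ _) hg.continuousAt
  have hSc : Continuous S := continuous_iff_continuousAt.2 fun x => (hSd x).continuousAt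
  have hSa : S a = 0 := by simp [hS]
  have hpt : ∀ x ∈ Set.Icc a b, f x ^ 2 * L ≤ E * (S x * (L - S x)) := by
    intro x hx
    have e1 : ∫ y in a..x, f' y = f x := by
      rw [intervalIntegral.integral_eq_sub_of_hasDerivAt (fun y _ => hf y)
        (hf'.intervalIntegrable _ _), hfa, sub_zero]
    have e2 : ∫ y in x..b, f' y = - f x := by
      rw [intervalIntegral.integral_eq_sub_of_hasDerivAt (fun y _ => hf y)
        (hf'.intervalIntegrable _ _), hfb, zero_sub]
    have c1 := sq_intervalIntegral_le hx.1 hf' he hg he0 hg0 h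
    have c2 := sq_intervalIntegral_le hx.2 hf' he hg he0 hg0 h
    rw [e1] at c1
    rw [e2] at c2
    have a1 : (∫ y in a..x, g y) + ∫ y in x..b, g y = L :=
      intervalIntegral.integral_add_adjacent_intervals (hg.intervalIntegrable _ _)
        (hg.intervalIntegrable _ _)
    have a2 : (∫ y in a..x, e y) + ∫ y in x..b, e y = E :=
      intervalIntegral.integral_add_adjacent_intervals (he.intervalIntegrable _ _)
        (he.intervalIntegrable _ _)
    have n1 : 0 ≤ ∫ y in a..x, g y := intervalIntegral.integral_nonneg hx.1 fun y _ => hg0 y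
    have n2 : 0 ≤ ∫ y in x..b, g y := intervalIntegral.integral_nonneg hx.2 fun y _ => hg0 y
    have hSx : S x = ∫ y in a..x, g y := rfl
    rw [hSx, ← a1, ← a2]
    nlinarith [mul_le_mul_of_nonneg_right c1 n2, mul_le_mul_of_nonneg_right c2 n1]
  have hint : (∫ x in a..b, f x ^ 2 * L * g x) ≤ ∫ x in a..b, E * (S x * (L - S x)) * g x := by
    apply intervalIntegral.integral_mono_on hab
    · exact Continuous.intervalIntegrable (by fun_prop) _ _
    · exact Continuous.intervalIntegrable (by fun_prop) _ _
    · exact fun x hx => mul_le_mul_of_nonneg_right (hpt x hx) (hg0 x)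
  have hprim : ∫ x in a..b, E * (S x * (L - S x)) * g x = E * L ^ 3 / 6 := by
    have hd : ∀ x, HasDerivAt (fun x => E * (S x ^ 2 * L / 2 - S x ^ 3 / 3))
        (E * (S x * (L - S x)) * g x) x := by
      intro x
      have := ((((hSd x).pow 2).mul_const L |>.div_const 2).sub
        (((hSd x).pow 3).div_const 3)).const_mul E
      refine this.congr_deriv ?_
      push_cast
      ring
    rw [intervalIntegral.integral_eq_sub_of_hasDerivAt (fun y _ => hd y)
      (Continuous.intervalIntegrable (by fun_prop) _ _), hSa, ← hL]
    ring
  have hl : (∫ x in a..b, f x ^ 2 * L * g x) = L * ∫ x in a..b, f x ^ 2 * g x := by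
    rw [← intervalIntegral.integral_const_mul]
    congr 1
    ext x
    ring
  rw [hprim, hl] at hint
  have hL0 : 0 ≤ L := intervalIntegral.integral_nonneg hab fun y _ => hg0 y
  have hE0 : 0 ≤ E := intervalIntegral.integral_nonneg hab fun y _ => he0 y
  change 6 * _ ≤ E * L ^ 2
  rcases hL0.eq_or_lt with h0 | h0
  · have hz : ∀ x ∈ Set.Icc a b, f x = 0 := by
      intro x hx
      have e1 : ∫ y in a..x, f' y = f x := by
        rw [intervalIntegral.integral_eq_sub_of_hasDerivAt (fun y _ => hf y)
          (hf'.intervalIntegrable _ _), hfa, sub_zero]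
      have c1 := sq_intervalIntegral_le hx.1 hf' he hg he0 hg0 h
      have a1 : (∫ y in a..x, g y) + ∫ y in x..b, g y = L :=
        intervalIntegral.integral_add_adjacent_intervals (hg.intervalIntegrable _ _)
          (hg.intervalIntegrable _ _)
      have n1 : 0 ≤ ∫ y in a..x, g y := intervalIntegral.integral_nonneg hx.1 fun y _ => hg0 y
      have n2 : 0 ≤ ∫ y in x..b, g y := intervalIntegral.integral_nonneg hx.2 fun y _ => hg0 y
      have : ∫ y in a..x, g y = 0 := by linarith
      rw [e1, this, mul_zero] at c1
      exact pow_eq_zero_iff (two_ne_zero) |>.1 (le_antisymm c1 (sq_nonneg _))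
    have : (∫ x in a..b, f x ^ 2 * g x) = ∫ x in a..b, (0 : ℝ) := by
      apply intervalIntegral.integral_congr
      intro x hx
      rw [Set.uIcc_of_le hab] at hx
      simp [hz x hx]
    rw [this, ← h0]
    simp
  · have : L * (6 * ∫ x in a..b, f x ^ 2 * g x) ≤ L * (E * L ^ 2) := by nlinarith
    exact le_of_mul_le_mul_left this h0

/-! ### Fluxes through circles -/

/-- The unit vector at angle `θ`. -/
def unitVec (θ : ℝ) : E2 :=
  cos θ • EuclideanSpace.single 0 1 + sin θ • EuclideanSpace.single 1 1

/-- The unit vector at angle `θ`, rotated by a right angle. -/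
def unitVecPerp (θ : ℝ) : E2 :=
  -sin θ • EuclideanSpace.single 0 1 + cos θ • EuclideanSpace.single 1 1

theorem continuous_unitVec : Continuous unitVec := by unfold unitVec; fun_prop

theorem continuous_unitVecPerp : Continuous unitVecPerp := by unfold unitVecPerp; fun_prop

theorem hasDerivAt_unitVec (θ : ℝ) : HasDerivAt unitVec (unitVecPerp θ) θ :=
  ((hasDerivAt_cos θ).smul_const _).add ((hasDerivAt_sin θ).smul_const _)

theorem unitVec_periodic : Function.Periodic unitVec (2 * π) := fun θ => by simp [unitVec]

theorem norm_unitVec (θ : ℝ) : ‖unitVec θ‖ = 1 := by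
  simp [EuclideanSpace.norm_eq, unitVec, Fin.sum_univ_two]

theorem exists_eq_smul_unitVec (x : E2) : ∃ θ, x = ‖x‖ • unitVec θ := by
  refine ⟨Complex.arg ⟨x 0, x 1⟩, ?_⟩
  have hn : ‖x‖ = ‖(⟨x 0, x 1⟩ : ℂ)‖ := by
    rw [EuclideanSpace.norm_eq, Complex.norm_eq_sqrt_sq_add_sq]
    simp [Fin.sum_univ_two]
  rw [hn]
  ext i
  fin_cases i
  · simp [unitVec]
  · simp [unitVec]

theorem map_unitVec (A : E2 →L[ℝ] ℝ) (θ : ℝ) : A (unitVec θ) =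
    cos θ * A (EuclideanSpace.single 0 1) + sin θ * A (EuclideanSpace.single 1 1) := by
  simp [unitVec]

theorem map_unitVecPerp (A : E2 →L[ℝ] ℝ) (θ : ℝ) : A (unitVecPerp θ) =
    -sin θ * A (EuclideanSpace.single 0 1) + cos θ * A (EuclideanSpace.single 1 1) := by
  simp [unitVecPerp]

theorem hasDerivAt_smul_unitVec_left {f : E2 → ℝ} {r θ : ℝ}
    (hf : DifferentiableAt ℝ f (r • unitVec θ)) :
    HasDerivAt (fun s : ℝ => f (s • unitVec θ)) (fderiv ℝ f (r • unitVec θ) (unitVec θ)) r := by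
  have h : HasDerivAt (fun s : ℝ => s • unitVec θ) (unitVec θ) r := by
    simpa using (hasDerivAt_id r).smul_const (unitVec θ)
  exact hf.hasFDerivAt.comp_hasDerivAt r h

theorem hasDerivAt_smul_unitVec_right {f : E2 → ℝ} {r θ : ℝ}
    (hf : DifferentiableAt ℝ f (r • unitVec θ)) :
    HasDerivAt (fun t : ℝ => f (r • unitVec t))
      (r * fderiv ℝ f (r • unitVec θ) (unitVecPerp θ)) θ := by
  have h : HasDerivAt (fun t : ℝ => f (r • unitVec t)) _ θ :=
    hf.hasFDerivAt.comp_hasDerivAt θ ((hasDerivAt_unitVec θ).const_smul r)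
  simpa using h

/-- The flux of the vector field `(X, Y)` through the circle of radius `r` differentiates to the
integral of its divergence over that circle. -/
theorem hasDerivAt_flux {X Y : E2 → ℝ} (hX : ContDiff ℝ 1 X) (hY : ContDiff ℝ 1 Y) (r : ℝ) :
    HasDerivAt (fun r : ℝ => r * ∫ θ in (0 : ℝ)..2 * π,
        (cos θ * X (r • unitVec θ) + sin θ * Y (r • unitVec θ)))
      (r * ∫ θ in (0 : ℝ)..2 * π, (fderiv ℝ X (r • unitVec θ) (EuclideanSpace.single 0 1) +
        fderiv ℝ Y (r • unitVec θ) (EuclideanSpace.single 1 1))) r := by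
  have hXd : Differentiable ℝ X := hX.differentiable one_ne_zero
  have hYd : Differentiable ℝ Y := hY.differentiable one_ne_zero
  have hXc : Continuous (fderiv ℝ X) := hX.continuous_fderiv one_ne_zero
  have hYc : Continuous (fderiv ℝ Y) := hY.continuous_fderiv one_ne_zero
  have hu := continuous_unitVec
  have hup := continuous_unitVecPerp
  have hX0 := hX.continuous
  have hY0 := hY.continuous
  set F' : ℝ → ℝ → ℝ := fun r θ => cos θ * fderiv ℝ X (r • unitVec θ) (unitVec θ) +
    sin θ * fderiv ℝ Y (r • unitVec θ) (unitVec θ) with hF'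
  have hF'c : Continuous (Function.uncurry F') := by
    simp only [hF', Function.uncurry_def]; fun_prop
  obtain ⟨C, hC⟩ : ∃ C, ∀ p ∈ Metric.closedBall r 1 ×ˢ Set.Icc 0 (2 * π),
      ‖Function.uncurry F' p‖ ≤ C :=
    ((isCompact_closedBall r 1).prod isCompact_Icc).exists_bound_of_continuousOn hF'c.continuousOn
  have hd := (intervalIntegral.hasDerivAt_integral_of_dominated_loc_of_deriv_le
    (μ := volume) (a := 0) (b := 2 * π) (bound := fun _ => C) (x₀ := r) (F' := F')
    (F := fun r θ => cos θ * X (r • unitVec θ) + sin θ * Y (r • unitVec θ))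
    (Metric.closedBall_mem_nhds r one_pos)
    (Filter.Eventually.of_forall fun s => (by fun_prop : Continuous _).aestronglyMeasurable)
    (Continuous.intervalIntegrable (by fun_prop) _ _)
    ((by simp only [hF']; fun_prop : Continuous (F' r)).aestronglyMeasurable)
    (Filter.Eventually.of_forall fun t ht s hs => by
      rw [Set.uIoc_of_le (by positivity)] at ht
      exact hC (s, t) ⟨hs, Set.Ioc_subset_Icc_self ht⟩)
    (by simp)
    (Filter.Eventually.of_forall fun t _ s _ =>
      ((hasDerivAt_smul_unitVec_left (hXd _)).const_mul _).add
        ((hasDerivAt_smul_unitVec_left (hYd _)).const_mul _))).2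
  have hprod := (hasDerivAt_id r).mul hd
  refine hprod.congr_deriv ?_
  simp only [id, one_mul]
  have hperp : ∀ θ, HasDerivAt
      (fun θ => -sin θ * X (r • unitVec θ) + cos θ * Y (r • unitVec θ))
      ((-cos θ * X (r • unitVec θ) - sin θ * (r * fderiv ℝ X (r • unitVec θ) (unitVecPerp θ))) +
        (-sin θ * Y (r • unitVec θ) + cos θ * (r * fderiv ℝ Y (r • unitVec θ) (unitVecPerp θ))))
      θ := by
    intro θ
    have h1 := ((hasDerivAt_sin θ).neg).mul (hasDerivAt_smul_unitVec_right (r := r) (hXd _))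
    have h2 := (hasDerivAt_cos θ).mul (hasDerivAt_smul_unitVec_right (r := r) (hYd _))
    refine (h1.add h2).congr_deriv ?_
    simp only [Pi.neg_apply]
    ring
  have hz := intervalIntegral.integral_eq_sub_of_hasDerivAt (a := 0) (b := 2 * π)
    (fun θ _ => hperp θ) (Continuous.intervalIntegrable (by fun_prop) _ _)
  have hper : unitVec (2 * π) = unitVec 0 := by simpa using unitVec_periodic 0
  rw [hper] at hz
  simp only [sin_two_pi, cos_two_pi, sin_zero, cos_zero, sub_self] at hz
  rw [← intervalIntegral.integral_const_mul, ← intervalIntegral.integral_const_mul,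
    ← intervalIntegral.integral_add]
  · refine ((add_zero _).symm.trans (congrArg (_ + ·) hz.symm)).trans ?_
    rw [← intervalIntegral.integral_add]
    · refine intervalIntegral.integral_congr fun θ _ => ?_
      simp only [hF', map_unitVec, map_unitVecPerp]
      have := sin_sq_add_cos_sq θ
      linear_combination r * (fderiv ℝ X (r • unitVec θ) (EuclideanSpace.single 0 1) +
        fderiv ℝ Y (r • unitVec θ) (EuclideanSpace.single 1 1)) * this
    all_goals
      try simp only [hF']
      exact Continuous.intervalIntegrable (by fun_prop) _ _
  all_goals
    try simp only [hF']
    exact Continuous.intervalIntegrable (by fun_prop) _ _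

/-! ### Positive minimal graphs extended by zero -/

/-- The first partial derivative. -/
def partialX (v : E2 → ℝ) (x : E2) : ℝ := fderiv ℝ v x (EuclideanSpace.single 0 1)

/-- The second partial derivative. -/
def partialY (v : E2 → ℝ) (x : E2) : ℝ := fderiv ℝ v x (EuclideanSpace.single 1 1)

/-- The area element `√(1 + |∇v|²)` of the graph of `v`. -/
def areaElement (v : E2 → ℝ) (x : E2) : ℝ := √(1 + (partialX v x ^ 2 + partialY v x ^ 2))

/-- The energy density `|∇v|² / √(1 + |∇v|²)`. -/
def energyDensity (v : E2 → ℝ) (x : E2) : ℝ :=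
  (partialX v x ^ 2 + partialY v x ^ 2) / areaElement v x

theorem gradient_apply (v : E2 → ℝ) (x : E2) (i : Fin 2) :
    gradient v x i = fderiv ℝ v x (EuclideanSpace.single i 1) := by
  rw [← toDual_gradient, InnerProductSpace.toDual_apply_apply, EuclideanSpace.inner_single_right]
  simp

theorem sqrt_one_add_norm_gradient_sq (v : E2 → ℝ) (x : E2) :
    √(1 + ‖gradient v x‖ ^ 2) = areaElement v x := by
  rw [EuclideanSpace.norm_sq_eq]
  simp [Fin.sum_univ_two, gradient_apply, areaElement, partialX, partialY]

theorem msDiv_eq (v : E2 → ℝ) (x : E2) : msDiv v x =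
    fderiv ℝ (fun y => (areaElement v y)⁻¹ * partialX v y) x (EuclideanSpace.single 0 1) +
    fderiv ℝ (fun y => (areaElement v y)⁻¹ * partialY v y) x (EuclideanSpace.single 1 1) := by
  simp [msDiv, Fin.sum_univ_two, sqrt_one_add_norm_gradient_sq, gradient_apply, partialX, partialY]

theorem one_le_areaElement (v : E2 → ℝ) (x : E2) : 1 ≤ areaElement v x :=
  Real.one_le_sqrt.2 (by nlinarith [sq_nonneg (partialX v x), sq_nonneg (partialY v x)])

theorem areaElement_pos (v : E2 → ℝ) (x : E2) : 0 < areaElement v x :=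
  one_pos.trans_le (one_le_areaElement v x)

theorem areaElement_sq (v : E2 → ℝ) (x : E2) :
    areaElement v x ^ 2 = 1 + (partialX v x ^ 2 + partialY v x ^ 2) :=
  Real.sq_sqrt (by positivity)

theorem energyDensity_nonneg (v : E2 → ℝ) (x : E2) : 0 ≤ energyDensity v x :=
  div_nonneg (by positivity) (areaElement_pos v x).le

theorem areaElement_le (v : E2 → ℝ) (x : E2) : areaElement v x ≤ 1 + energyDensity v x := by
  have h := one_le_areaElement v x
  have h0 := areaElement_pos v x
  have : energyDensity v x = areaElement v x - 1 / areaElement v x := by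
    rw [energyDensity, eq_sub_iff_add_eq, ← add_div, div_eq_iff h0.ne']
    linarith [areaElement_sq v x]
  have h1 : 1 / areaElement v x ≤ 1 := (div_le_one h0).2 h
  linarith

theorem fderiv_unitVec (v : E2 → ℝ) (x : E2) (θ : ℝ) :
    fderiv ℝ v x (unitVec θ) = cos θ * partialX v x + sin θ * partialY v x :=
  map_unitVec _ _

theorem fderiv_unitVec_sq_add (v : E2 → ℝ) (x : E2) (θ : ℝ) :
    fderiv ℝ v x (unitVec θ) ^ 2 + fderiv ℝ v x (unitVecPerp θ) ^ 2 =
      partialX v x ^ 2 + partialY v x ^ 2 := by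
  rw [map_unitVec, map_unitVecPerp, partialX, partialY]
  linear_combination (fderiv ℝ v x (EuclideanSpace.single 0 1) ^ 2 +
    fderiv ℝ v x (EuclideanSpace.single 1 1) ^ 2) * sin_sq_add_cos_sq θ

theorem abs_fderiv_unitVec_le (v : E2 → ℝ) (x : E2) (θ : ℝ) :
    |fderiv ℝ v x (unitVec θ)| ≤ areaElement v x := by
  refine abs_le_of_sq_le_sq ?_ (areaElement_pos v x).le
  nlinarith [areaElement_sq v x, fderiv_unitVec_sq_add v x θ,
    sq_nonneg (fderiv ℝ v x (unitVecPerp θ))]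

/-- A nonnegative continuous function on the plane whose restriction to its positivity set is a
smooth solution of the minimal surface equation. -/
structure IsPositiveMinimal (v : E2 → ℝ) : Prop where
  continuous : Continuous v
  nonneg : ∀ x, 0 ≤ v x
  contDiffAt : ∀ x, 0 < v x → ContDiffAt ℝ 2 v x
  msDiv_eq_zero : ∀ x, 0 < v x → msDiv v x = 0

/-- A `C¹` function with derivative `T'` that vanishes, together with `T'`, below a positive level. -/
structure IsTruncation (T T' : ℝ → ℝ) : Prop where
  hasDerivAt : ∀ s, HasDerivAt T (T' s) s
  continuous_deriv : Continuous T'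
  exists_vanish : ∃ b > 0, ∀ s ≤ b, T s = 0 ∧ T' s = 0

theorem continuous_comp_mul {Y : Type*} [TopologicalSpace Y] {T : ℝ → ℝ} (hT : Continuous T)
    (hb : ∃ b > 0, ∀ s ≤ b, T s = 0) {w B : Y → ℝ} (hw : Continuous w)
    (hB : ∀ y, 0 < w y → ContinuousAt B y) : Continuous fun y => T (w y) * B y := by
  obtain ⟨b, hb0, hb⟩ := hb
  refine continuous_iff_continuousAt.2 fun y => ?_
  rcases lt_or_ge 0 (w y) with h | h
  · exact (hT.comp hw).continuousAt.mul (hB y h)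
  · have : ∀ᶠ z in nhds y, w z < b := hw.continuousAt.eventually_lt_const (h.trans_lt hb0)
    refine (continuousAt_const (y := (0 : ℝ))).congr ?_
    filter_upwards [this] with z hz
    rw [hb _ hz.le, zero_mul]

namespace IsTruncation

variable {T T' : ℝ → ℝ}

theorem continuous (h : IsTruncation T T') : Continuous T :=
  continuous_iff_continuousAt.2 fun s => (h.hasDerivAt s).continuousAt

theorem contDiff (h : IsTruncation T T') : ContDiff ℝ 1 T := by
  refine contDiff_one_iff_deriv.2 ⟨fun s => (h.hasDerivAt s).differentiableAt, ?_⟩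
  rw [funext fun s => (h.hasDerivAt s).deriv]
  exact h.continuous_deriv

theorem vanish (h : IsTruncation T T') : ∃ b > 0, ∀ s ≤ b, T s = 0 :=
  h.exists_vanish.imp fun _ hb => ⟨hb.1, fun s hs => (hb.2 s hs).1⟩

theorem vanish_deriv (h : IsTruncation T T') : ∃ b > 0, ∀ s ≤ b, T' s = 0 :=
  h.exists_vanish.imp fun _ hb => ⟨hb.1, fun s hs => (hb.2 s hs).2⟩

end IsTruncation

/-- The flux of the field `T(v) ∇v / √(1 + |∇v|²)` through the circle of radius `r`. -/
def flux (T : ℝ → ℝ) (v : E2 → ℝ) (r : ℝ) : ℝ :=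
  r * ∫ θ in (0 : ℝ)..2 * π, T (v (r • unitVec θ)) *
    (fderiv ℝ v (r • unitVec θ) (unitVec θ) / areaElement v (r • unitVec θ))

/-- The derivative of `flux`. -/
def fluxDeriv (T' : ℝ → ℝ) (v : E2 → ℝ) (r : ℝ) : ℝ :=
  r * ∫ θ in (0 : ℝ)..2 * π, T' (v (r • unitVec θ)) * energyDensity v (r • unitVec θ)

/-- The length of the circle of radius `r`, weighted by `χ(v) √(1 + |∇v|²)`. -/
def weightedLength (χ : ℝ → ℝ) (v : E2 → ℝ) (r : ℝ) : ℝ :=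
  r * ∫ θ in (0 : ℝ)..2 * π, χ (v (r • unitVec θ)) * areaElement v (r • unitVec θ)

namespace IsPositiveMinimal

variable {v : E2 → ℝ} {T T' : ℝ → ℝ}

theorem contDiffAt_fderiv (hv : IsPositiveMinimal v) {x : E2} (hx : 0 < v x) :
    ContDiffAt ℝ 1 (fderiv ℝ v) x :=
  (hv.contDiffAt x hx).fderiv_right (by norm_num)

theorem contDiffAt_partialX (hv : IsPositiveMinimal v) {x : E2} (hx : 0 < v x) :
    ContDiffAt ℝ 1 (partialX v) x :=
  (hv.contDiffAt_fderiv hx).clm_apply contDiffAt_const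

theorem contDiffAt_partialY (hv : IsPositiveMinimal v) {x : E2} (hx : 0 < v x) :
    ContDiffAt ℝ 1 (partialY v) x :=
  (hv.contDiffAt_fderiv hx).clm_apply contDiffAt_const

theorem contDiffAt_areaElement (hv : IsPositiveMinimal v) {x : E2} (hx : 0 < v x) :
    ContDiffAt ℝ 1 (areaElement v) x := by
  have h : ContDiffAt ℝ 1 (fun y => 1 + (partialX v y ^ 2 + partialY v y ^ 2)) x :=
    contDiffAt_const.add (((hv.contDiffAt_partialX hx).pow 2).add
      ((hv.contDiffAt_partialY hx).pow 2))
  exact h.sqrt (by positivity)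

theorem continuousAt_energyDensity (hv : IsPositiveMinimal v) {x : E2} (hx : 0 < v x) :
    ContinuousAt (energyDensity v) x :=
  (((hv.contDiffAt_partialX hx).continuousAt.pow 2).add
    ((hv.contDiffAt_partialY hx).continuousAt.pow 2)).div
    (hv.contDiffAt_areaElement hx).continuousAt (areaElement_pos v x).ne'

theorem contDiff_comp_mul (hv : IsPositiveMinimal v) (hT : IsTruncation T T') {B : E2 → ℝ}
    (hB : ∀ x, 0 < v x → ContDiffAt ℝ 1 B x) : ContDiff ℝ 1 fun x => T (v x) * B x := by
  obtain ⟨b, hb0, hb⟩ := hT.vanish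
  refine contDiff_iff_contDiffAt.2 fun x => ?_
  rcases lt_or_ge 0 (v x) with h | h
  · exact (hT.contDiff.contDiffAt.comp x ((hv.contDiffAt x h).of_le (by norm_num))).mul (hB x h)
  · have : ∀ᶠ z in nhds x, v z < b :=
      hv.continuous.continuousAt.eventually_lt_const (h.trans_lt hb0)
    refine (contDiffAt_const (c := (0 : ℝ))).congr_of_eventuallyEq ?_
    filter_upwards [this] with z hz
    rw [hb _ hz.le, zero_mul]

theorem fderiv_comp_mul (hv : IsPositiveMinimal v) (hT : IsTruncation T T') {B : E2 → ℝ}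
    (hB : ∀ x, 0 < v x → ContDiffAt ℝ 1 B x) (x w : E2) :
    fderiv ℝ (fun x => T (v x) * B x) x w =
      T' (v x) * fderiv ℝ v x w * B x + T (v x) * fderiv ℝ B x w := by
  rcases lt_or_ge 0 (v x) with h | h
  · have h1 : HasFDerivAt (fun x => T (v x)) (T' (v x) • fderiv ℝ v x) x :=
      (hT.hasDerivAt (v x)).comp_hasFDerivAt x
        ((hv.contDiffAt x h).differentiableAt two_ne_zero).hasFDerivAt
    have h2 := h1.mul ((hB x h).differentiableAt one_ne_zero).hasFDerivAt
    have h3 : fderiv ℝ (fun x => T (v x) * B x) x = _ := h2.fderiv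
    rw [h3]
    simp
    ring
  · obtain ⟨b, hb0, hb⟩ := hT.exists_vanish
    have : ∀ᶠ z in nhds x, v z < b :=
      hv.continuous.continuousAt.eventually_lt_const (h.trans_lt hb0)
    have he : (fun x => T (v x) * B x) =ᶠ[nhds x] fun _ => (0 : ℝ) := by
      filter_upwards [this] with z hz
      rw [(hb _ hz.le).1, zero_mul]
    have hx := hb (v x) (h.trans hb0.le)
    rw [he.fderiv_eq, hx.1, hx.2]
    simp

theorem hasDerivAt_flux (hv : IsPositiveMinimal v) (hT : IsTruncation T T') (r : ℝ) :
    HasDerivAt (flux T v) (fluxDeriv T' v r) r := by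
  have hX : ∀ x, 0 < v x → ContDiffAt ℝ 1 (fun x => (areaElement v x)⁻¹ * partialX v x) x :=
    fun x hx => ((hv.contDiffAt_areaElement hx).inv (areaElement_pos v x).ne').mul
      (hv.contDiffAt_partialX hx)
  have hY : ∀ x, 0 < v x → ContDiffAt ℝ 1 (fun x => (areaElement v x)⁻¹ * partialY v x) x :=
    fun x hx => ((hv.contDiffAt_areaElement hx).inv (areaElement_pos v x).ne').mul
      (hv.contDiffAt_partialY hx)
  have h := _root_.hasDerivAt_flux (hv.contDiff_comp_mul hT hX) (hv.contDiff_comp_mul hT hY) r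
  have e1 : flux T v = fun r : ℝ => r * ∫ θ in (0 : ℝ)..2 * π,
      (cos θ * (T (v (r • unitVec θ)) *
        ((areaElement v (r • unitVec θ))⁻¹ * partialX v (r • unitVec θ))) +
      sin θ * (T (v (r • unitVec θ)) *
        ((areaElement v (r • unitVec θ))⁻¹ * partialY v (r • unitVec θ)))) := by
    ext r
    unfold flux
    congr 1
    refine intervalIntegral.integral_congr fun θ _ => ?_
    simp only [fderiv_unitVec, div_eq_mul_inv]
    ring
  rw [e1]
  refine h.congr_deriv ?_
  unfold fluxDeriv
  congr 1
  refine intervalIntegral.integral_congr fun θ _ => ?_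
  set x := r • unitVec θ with hx
  simp only [hv.fderiv_comp_mul hT hX, hv.fderiv_comp_mul hT hY]
  have hm : T (v x) * msDiv v x = 0 := by
    rcases lt_or_ge 0 (v x) with h | h
    · rw [hv.msDiv_eq_zero x h, mul_zero]
    · obtain ⟨b, hb0, hb⟩ := hT.vanish
      rw [hb _ (h.trans hb0.le), zero_mul]
  rw [msDiv_eq] at hm
  simp only [energyDensity, div_eq_mul_inv]
  change T' (v x) * partialX v x * _ + _ + (T' (v x) * partialY v x * _ + _) = _
  linear_combination hm

end IsPositiveMinimal

/-! ### The truncations -/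

theorem hasDerivAt_max_zero_sq (s : ℝ) : HasDerivAt (fun s : ℝ => max s 0 ^ 2) (2 * max s 0) s := by
  have hne : ∀ y : ℝ, y ≠ 0 → HasDerivAt (fun s : ℝ => max s 0 ^ 2) (2 * max y 0) y := by
    intro y hy
    rcases lt_or_gt_of_ne hy with h | h
    · rw [max_eq_right h.le, mul_zero]
      refine (hasDerivAt_const y (0 : ℝ)).congr_of_eventuallyEq ?_
      filter_upwards [eventually_lt_nhds h] with z hz
      simp [hz.le]
    · rw [max_eq_left h.le]
      have := hasDerivAt_pow 2 y
      refine HasDerivAt.congr_of_eventuallyEq (f := fun s => s ^ 2) (by simpa using this) ?_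
      filter_upwards [eventually_gt_nhds h] with z hz
      simp [hz.le]
  rcases eq_or_ne s 0 with rfl | h
  · exact hasDerivAt_of_hasDerivAt_of_ne hne (by fun_prop) (by fun_prop)
  · exact hne s h

theorem hasDerivAt_mul_sqrt (s : ℝ) : HasDerivAt (fun s : ℝ => s * √s) (3 / 2 * √s) s := by
  have hne : ∀ y : ℝ, y ≠ 0 → HasDerivAt (fun s : ℝ => s * √s) (3 / 2 * √y) y := by
    intro y hy
    have := (hasDerivAt_id y).mul (Real.hasDerivAt_sqrt hy)
    refine this.congr_deriv ?_
    rcases lt_or_gt_of_ne hy with h | h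
    · simp [Real.sqrt_eq_zero_of_nonpos h.le]
    · have h0 := Real.sqrt_pos.2 h
      have := Real.sq_sqrt h.le
      simp only [id]
      field_simp
      linarith
  rcases eq_or_ne s 0 with rfl | h
  · exact hasDerivAt_of_hasDerivAt_of_ne hne (by fun_prop) (by fun_prop)
  · exact hne s h

/-- A piecewise linear cutoff, which is `0` below `a` and `1` above `2a`. -/
def cutoff (a s : ℝ) : ℝ := (max (s - a) 0 - max (s - 2 * a) 0) / a

/-- The primitive of `cutoff a`. -/
def cutoffPrimitive (a s : ℝ) : ℝ := (max (s - a) 0 ^ 2 - max (s - 2 * a) 0 ^ 2) / (2 * a)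

/-- The squared excess over the level `2a`. -/
def excessSq (a s : ℝ) : ℝ := max (s - 2 * a) 0 ^ 2

/-- The derivative of `excessSq a`. -/
def excessSqDeriv (a s : ℝ) : ℝ := 2 * max (s - 2 * a) 0

section Truncations

variable {a : ℝ}

theorem isTruncation_cutoffPrimitive (ha : 0 < a) :
    IsTruncation (cutoffPrimitive a) (cutoff a) where
  hasDerivAt s := by
    have h1 := (hasDerivAt_max_zero_sq (s - a)).comp s ((hasDerivAt_id s).sub_const a)
    have h2 := (hasDerivAt_max_zero_sq (s - 2 * a)).comp s ((hasDerivAt_id s).sub_const (2 * a))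
    refine ((h1.sub h2).div_const (2 * a)).congr_deriv ?_
    unfold cutoff
    field_simp
  continuous_deriv := by unfold cutoff; fun_prop
  exists_vanish := ⟨a, ha, fun s hs => by
    have h1 : max (s - a) 0 = 0 := max_eq_right (by linarith)
    have h2 : max (s - 2 * a) 0 = 0 := max_eq_right (by linarith)
    simp [cutoffPrimitive, cutoff, h1, h2]⟩

theorem isTruncation_excessSq (ha : 0 < a) : IsTruncation (excessSq a) (excessSqDeriv a) where
  hasDerivAt s := by
    have h2 := (hasDerivAt_max_zero_sq (s - 2 * a)).comp s ((hasDerivAt_id s).sub_const (2 * a))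
    refine h2.congr_deriv ?_
    simp [excessSqDeriv]
  continuous_deriv := by unfold excessSqDeriv; fun_prop
  exists_vanish := ⟨2 * a, by positivity, fun s hs => by
    have h2 : max (s - 2 * a) 0 = 0 := max_eq_right (by linarith)
    simp [excessSq, excessSqDeriv, h2]⟩

theorem excessSq_nonneg (a s : ℝ) : 0 ≤ excessSq a s := sq_nonneg _

theorem excessSqDeriv_nonneg (a s : ℝ) : 0 ≤ excessSqDeriv a s :=
  mul_nonneg two_pos.le (le_max_right _ _)

theorem excessSq_le (ha : 0 < a) {s : ℝ} (hs : 0 ≤ s) : excessSq a s ≤ s ^ 2 :=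
  pow_le_pow_left₀ (le_max_right _ _) (max_le (by linarith) hs) 2

theorem cutoff_nonneg (ha : 0 < a) (s : ℝ) : 0 ≤ cutoff a s :=
  div_nonneg (sub_nonneg.2 (max_le_max_right 0 (by linarith))) ha.le

theorem cutoff_le_one (ha : 0 < a) (s : ℝ) : cutoff a s ≤ 1 := by
  rw [cutoff, div_le_one ha, sub_le_iff_le_add]
  exact max_le (by linarith [le_max_left (s - 2 * a) 0]) (by linarith [le_max_right (s - 2 * a) 0])

theorem cutoff_eq_one (ha : 0 < a) {s : ℝ} (hs : 2 * a ≤ s) : cutoff a s = 1 := by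
  rw [cutoff, max_eq_left (by linarith), max_eq_left (by linarith), div_eq_one_iff_eq ha.ne']
  ring

theorem cutoff_of_nonpos (ha : 0 < a) {s : ℝ} (hs : s ≤ 0) : cutoff a s = 0 := by
  rw [cutoff, max_eq_right (by linarith), max_eq_right (by linarith), sub_zero, zero_div]

theorem cutoffPrimitive_nonneg (ha : 0 < a) (s : ℝ) : 0 ≤ cutoffPrimitive a s :=
  div_nonneg (sub_nonneg.2 (pow_le_pow_left₀ (le_max_right _ _)
    (max_le_max_right 0 (by linarith)) 2)) (by positivity)

theorem cutoffPrimitive_le (ha : 0 < a) {s : ℝ} (hs : 0 ≤ s) : cutoffPrimitive a s ≤ s := by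
  have h1 : max (s - a) 0 - max (s - 2 * a) 0 ≤ a := by
    have := cutoff_le_one ha s
    rwa [cutoff, div_le_one ha] at this
  have h2 : max (s - a) 0 ≤ s := max_le (by linarith) hs
  have h3 : max (s - 2 * a) 0 ≤ s := max_le (by linarith) hs
  have h4 : 0 ≤ max (s - a) 0 := le_max_right _ _
  have h5 : 0 ≤ max (s - 2 * a) 0 := le_max_right _ _
  rw [cutoffPrimitive, div_le_iff₀ (by positivity)]
  nlinarith [mul_le_mul_of_nonneg_right h1 (add_nonneg h4 h5)]

end Truncations

/-! ### The differential inequality for the flux -/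

theorem intervalIntegral_two_pi_eq {f : ℝ → ℝ} (hf : Function.Periodic f (2 * π)) (t : ℝ) :
    ∫ θ in (0 : ℝ)..2 * π, f θ = ∫ θ in t..t + 2 * π, f θ := by
  have := hf.intervalIntegral_add_eq 0 t
  rwa [zero_add] at this

namespace IsPositiveMinimal

variable {v : E2 → ℝ} {a r : ℝ}

theorem continuous_circle (hv : IsPositiveMinimal v) (r : ℝ) :
    Continuous fun θ => v (r • unitVec θ) :=
  hv.continuous.comp (continuous_unitVec.const_smul r)

theorem continuousAt_fderiv_circle (hv : IsPositiveMinimal v) {θ : ℝ}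
    (h : 0 < v (r • unitVec θ)) : ContinuousAt (fun θ => fderiv ℝ v (r • unitVec θ)) θ :=
  ContinuousAt.comp (f := fun θ => r • unitVec θ) (hv.contDiffAt_fderiv h).continuousAt
    (continuous_unitVec.const_smul r).continuousAt

theorem continuousAt_areaElement_circle (hv : IsPositiveMinimal v) {θ : ℝ}
    (h : 0 < v (r • unitVec θ)) : ContinuousAt (fun θ => areaElement v (r • unitVec θ)) θ :=
  ContinuousAt.comp (f := fun θ => r • unitVec θ) (hv.contDiffAt_areaElement h).continuousAt
    (continuous_unitVec.const_smul r).continuousAt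

theorem continuousAt_energyDensity_circle (hv : IsPositiveMinimal v) {θ : ℝ}
    (h : 0 < v (r • unitVec θ)) : ContinuousAt (fun θ => energyDensity v (r • unitVec θ)) θ :=
  ContinuousAt.comp (f := fun θ => r • unitVec θ) (hv.continuousAt_energyDensity h)
    (continuous_unitVec.const_smul r).continuousAt

/-- If the truncated graph vanishes somewhere on the circle of radius `r`, its flux is controlled
by the weighted length of the circle and the derivative of the flux. -/
theorem flux_sq_le (hv : IsPositiveMinimal v) (ha : 0 < a) {θ₀ : ℝ}
    (h0 : v (r • unitVec θ₀) ≤ 2 * a) :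
    128 * flux (excessSq a) v r ^ 2 ≤
      3 * (weightedLength (cutoff a) v r ^ 2 * fluxDeriv (excessSqDeriv a) v r ^ 2) := by
  have hE := isTruncation_excessSq ha
  have hK := isTruncation_cutoffPrimitive ha
  set w : ℝ → ℝ := fun θ => v (r • unitVec θ) with hw
  set W : ℝ → ℝ := fun θ => areaElement v (r • unitVec θ) with hW
  set vr : ℝ → ℝ := fun θ => fderiv ℝ v (r • unitVec θ) (unitVec θ) with hvr
  set vt : ℝ → ℝ := fun θ => fderiv ℝ v (r • unitVec θ) (unitVecPerp θ) with hvt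
  have hwc : Continuous w := hv.continuous_circle r
  have hWc : ∀ θ, 0 < w θ → ContinuousAt W θ := fun θ h => hv.continuousAt_areaElement_circle h
  have hvrc : ∀ θ, 0 < w θ → ContinuousAt vr θ := fun θ h =>
    (hv.continuousAt_fderiv_circle h).clm_apply continuous_unitVec.continuousAt
  have hvtc : ∀ θ, 0 < w θ → ContinuousAt vt θ := fun θ h =>
    (hv.continuousAt_fderiv_circle h).clm_apply continuous_unitVecPerp.continuousAt
  have hW1 : ∀ θ, 1 ≤ W θ := fun θ => one_le_areaElement v _
  have hW0 : ∀ θ, 0 < W θ := fun θ => areaElement_pos v _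
  have hexc : ∃ b > 0, ∀ s ≤ b, max (s - 2 * a) 0 = 0 :=
    ⟨2 * a, by positivity, fun s hs => max_eq_right (by linarith)⟩
  have hmaxc : Continuous fun s : ℝ => max (s - 2 * a) 0 := by fun_prop
  set f : ℝ → ℝ := fun θ => (w θ - 2 * a) * √(w θ - 2 * a) with hf
  set f' : ℝ → ℝ := fun θ => √(w θ - 2 * a) * (3 / 2 * (r * vt θ)) with hf'
  set g : ℝ → ℝ := fun θ => cutoff a (w θ) * W θ with hg
  set e : ℝ → ℝ := fun θ => max (w θ - 2 * a) 0 * (vt θ ^ 2 / W θ) with he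
  set q : ℝ → ℝ := fun θ => max (w θ - 2 * a) 0 * (vr θ ^ 2 / W θ) with hq
  set m : ℝ → ℝ := fun θ => excessSq a (w θ) * (vr θ / W θ) with hm
  have hgc : Continuous g :=
    continuous_comp_mul hK.continuous_deriv hK.vanish_deriv hwc hWc
  have hec : Continuous e := continuous_comp_mul hmaxc hexc hwc fun θ h =>
    ((hvtc θ h).pow 2).div (hWc θ h) (hW0 θ).ne'
  have hqc : Continuous q := continuous_comp_mul hmaxc hexc hwc fun θ h =>
    ((hvrc θ h).pow 2).div (hWc θ h) (hW0 θ).ne'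
  have hmc : Continuous m := continuous_comp_mul hE.continuous hE.vanish hwc fun θ h =>
    (hvrc θ h).div (hWc θ h) (hW0 θ).ne'
  have hf'c : Continuous f' := continuous_comp_mul (T := fun s => √(s - 2 * a)) (by fun_prop)
    ⟨2 * a, by positivity, fun s hs => Real.sqrt_eq_zero_of_nonpos (by linarith)⟩ hwc
    fun θ h => ((hvtc θ h).const_mul r).const_mul (3 / 2)
  have hfd : ∀ θ, HasDerivAt f (f' θ) θ := by
    intro θ
    rcases lt_or_ge 0 (w θ) with h | h
    · have h1 : HasDerivAt w (r * vt θ) θ := hasDerivAt_smul_unitVec_right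
        ((hv.contDiffAt _ h).differentiableAt two_ne_zero)
      have h2 := (hasDerivAt_mul_sqrt (w θ - 2 * a)).comp θ (h1.sub_const (2 * a))
      refine h2.congr_deriv ?_
      simp only [hf']
      ring
    · have hz : ∀ᶠ t in nhds θ, w t < 2 * a :=
        hwc.continuousAt.eventually_lt_const (h.trans_lt (by positivity))
      have : f' θ = 0 := by
        simp only [hf']
        rw [Real.sqrt_eq_zero_of_nonpos (by linarith), zero_mul]
      rw [this]
      refine (hasDerivAt_const θ (0 : ℝ)).congr_of_eventuallyEq ?_
      filter_upwards [hz] with t ht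
      simp only [hf]
      rw [Real.sqrt_eq_zero_of_nonpos (by linarith), mul_zero]
  have hwper : Function.Periodic w (2 * π) := fun θ => by
    simp only [hw, unitVec_periodic θ]
  have hgper : Function.Periodic g (2 * π) := fun θ => by
    simp only [hg, hw, hW, unitVec_periodic θ]
  have hmper : Function.Periodic m (2 * π) := fun θ => by
    simp only [hm, hw, hvr, hW, unitVec_periodic θ]
  have hdper : Function.Periodic (fun θ => excessSqDeriv a (v (r • unitVec θ)) *
      energyDensity v (r • unitVec θ)) (2 * π) := fun θ => by
    simp only [unitVec_periodic θ]
  have hle : θ₀ ≤ θ₀ + 2 * π := by linarith [pi_pos]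
  have hg0 : ∀ θ, 0 ≤ g θ := fun θ => mul_nonneg (cutoff_nonneg ha _) (hW0 θ).le
  have he0 : ∀ θ, 0 ≤ e θ := fun θ =>
    mul_nonneg (le_max_right _ _) (div_nonneg (sq_nonneg _) (hW0 θ).le)
  have hq0 : ∀ θ, 0 ≤ q θ := fun θ =>
    mul_nonneg (le_max_right _ _) (div_nonneg (sq_nonneg _) (hW0 θ).le)
  have hf0 : f θ₀ = 0 := by
    simp only [hf]
    rw [Real.sqrt_eq_zero_of_nonpos (by linarith), mul_zero]
  have hf1 : f (θ₀ + 2 * π) = 0 := by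
    rw [← hf0]
    simp only [hf, hwper θ₀]
  have hwirt := intervalIntegral_sq_mul_le_of_deriv_sq_le hle hfd hf'c
    (e := fun θ => 9 / 4 * r ^ 2 * e θ) (hec.const_mul _) hgc
    (fun θ => mul_nonneg (by positivity) (he0 θ)) hg0 (fun θ => by
      rcases le_or_gt (2 * a) (w θ) with h | h
      · have hs := Real.sq_sqrt (sub_nonneg.2 h)
        have : f' θ ^ 2 = 9 / 4 * r ^ 2 * (w θ - 2 * a) * vt θ ^ 2 := by
          simp only [hf', mul_pow, hs]
          ring
        rw [this]
        simp only [he, hg]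
        rw [cutoff_eq_one ha h, max_eq_left (sub_nonneg.2 h)]
        have := (hW0 θ).ne'
        apply le_of_eq
        field_simp
      · have : f' θ = 0 := by
          simp only [hf']
          rw [Real.sqrt_eq_zero_of_nonpos (by linarith), zero_mul]
        rw [this]
        simpa using mul_nonneg (mul_nonneg (by positivity) (he0 θ)) (hg0 θ)) hf0 hf1
  have hcs := sq_intervalIntegral_le hle hmc (p := fun θ => f θ ^ 2 * g θ)
    ((((continuous_iff_continuousAt.2 fun θ => (hfd θ).continuousAt).pow 2).mul hgc)) hqc
    (fun θ => mul_nonneg (sq_nonneg _) (hg0 θ)) hq0 (fun θ => by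
      rcases le_or_gt (2 * a) (w θ) with h | h
      · have hs := Real.sq_sqrt (sub_nonneg.2 h)
        simp only [hf, hg, hq, hm, excessSq, mul_pow, hs]
        rw [cutoff_eq_one ha h, max_eq_left (sub_nonneg.2 h), div_pow]
        have h1 : ((w θ - 2 * a) ^ 2) ^ 2 * (vr θ ^ 2 / W θ ^ 2) =
            (w θ - 2 * a) ^ 4 * vr θ ^ 2 / W θ ^ 2 := by ring
        have h2 : (w θ - 2 * a) ^ 2 * (w θ - 2 * a) * (1 * W θ) *
            ((w θ - 2 * a) * (vr θ ^ 2 / W θ)) = (w θ - 2 * a) ^ 4 * vr θ ^ 2 := by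
          have := (hW0 θ).ne'
          field_simp
        rw [h1, h2]
        exact div_le_self (by positivity) (one_le_pow₀ (hW1 θ))
      · have : m θ = 0 := by
          simp only [hm, excessSq]
          rw [max_eq_right (by linarith)]
          simp
        rw [this]
        simpa using mul_nonneg (mul_nonneg (sq_nonneg (f θ)) (hg0 θ)) (hq0 θ))
  have hflux : flux (excessSq a) v r = r * ∫ θ in θ₀..θ₀ + 2 * π, m θ := by
    rw [← intervalIntegral_two_pi_eq hmper]
    rfl
  have hlen : weightedLength (cutoff a) v r = r * ∫ θ in θ₀..θ₀ + 2 * π, g θ := by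
    rw [← intervalIntegral_two_pi_eq hgper]
    rfl
  have hder : fluxDeriv (excessSqDeriv a) v r =
      r * (2 * ((∫ θ in θ₀..θ₀ + 2 * π, e θ) + ∫ θ in θ₀..θ₀ + 2 * π, q θ)) := by
    rw [fluxDeriv, intervalIntegral_two_pi_eq hdper θ₀,
      ← intervalIntegral.integral_add (hec.intervalIntegrable _ _) (hqc.intervalIntegrable _ _),
      ← intervalIntegral.integral_const_mul 2]
    congr 1
    refine intervalIntegral.integral_congr fun θ _ => ?_
    simp only [he, hq, excessSqDeriv, energyDensity, ← fderiv_unitVec_sq_add v _ θ]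
    ring
  rw [intervalIntegral.integral_const_mul] at hwirt
  rw [hflux, hlen, hder]
  have hI : 0 ≤ ∫ θ in θ₀..θ₀ + 2 * π, q θ := intervalIntegral.integral_nonneg hle fun θ _ => hq0 θ
  generalize (∫ θ in θ₀..θ₀ + 2 * π, m θ) = M at *
  generalize (∫ θ in θ₀..θ₀ + 2 * π, f θ ^ 2 * g θ) = P at *
  generalize (∫ θ in θ₀..θ₀ + 2 * π, g θ) = G at *
  generalize (∫ θ in θ₀..θ₀ + 2 * π, e θ) = T at *
  generalize (∫ θ in θ₀..θ₀ + 2 * π, q θ) = Q at *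
  have s1 : 6 * M ^ 2 ≤ 9 / 4 * r ^ 2 * T * G ^ 2 * Q := by
    nlinarith [mul_le_mul_of_nonneg_right hwirt hI]
  have s2 : 4 * (T * Q) ≤ (T + Q) ^ 2 := by nlinarith [sq_nonneg (T - Q)]
  have s3 := mul_le_mul_of_nonneg_left s2 (by positivity : 0 ≤ 12 * (r ^ 4 * G ^ 2))
  have s4 := mul_le_mul_of_nonneg_left s1 (sq_nonneg r)
  nlinarith

theorem fluxDeriv_nonneg (hr : 0 ≤ r) {T' : ℝ → ℝ} (hT' : ∀ s, 0 ≤ T' s) :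
    0 ≤ fluxDeriv T' v r :=
  mul_nonneg hr (intervalIntegral.integral_nonneg (by positivity) fun _ _ =>
    mul_nonneg (hT' _) (energyDensity_nonneg _ _))

theorem weightedLength_nonneg (hr : 0 ≤ r) {χ : ℝ → ℝ} (hχ : ∀ s, 0 ≤ χ s) :
    0 ≤ weightedLength χ v r :=
  mul_nonneg hr (intervalIntegral.integral_nonneg (by positivity) fun _ _ =>
    mul_nonneg (hχ _) (areaElement_pos _ _).le)

theorem monotoneOn_flux (hv : IsPositiveMinimal v) {T T' : ℝ → ℝ} (hT : IsTruncation T T')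
    (hT' : ∀ s, 0 ≤ T' s) : MonotoneOn (flux T v) (Set.Ici 0) := by
  refine monotoneOn_of_deriv_nonneg (convex_Ici 0)
    (fun r _ => (hv.hasDerivAt_flux hT r).continuousAt.continuousWithinAt)
    (fun r _ => (hv.hasDerivAt_flux hT r).differentiableAt.differentiableWithinAt) ?_
  intro r hr
  rw [interior_Ici] at hr
  rw [(hv.hasDerivAt_flux hT r).deriv]
  exact fluxDeriv_nonneg (le_of_lt hr) hT'

theorem flux_nonneg (hv : IsPositiveMinimal v) {T T' : ℝ → ℝ} (hT : IsTruncation T T')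
    (hT' : ∀ s, 0 ≤ T' s) (hr : 0 ≤ r) : 0 ≤ flux T v r := by
  have := hv.monotoneOn_flux hT hT' Set.self_mem_Ici hr hr
  simpa [flux] using this

theorem flux_le (hv : IsPositiveMinimal v) {T T' : ℝ → ℝ} (hT : IsTruncation T T')
    (hT0 : ∀ s, 0 ≤ T s) (hr : 0 ≤ r) {C : ℝ} (hC : ∀ θ, T (v (r • unitVec θ)) ≤ C) :
    flux T v r ≤ r * (2 * π * C) := by
  refine mul_le_mul_of_nonneg_left ?_ hr
  have : ∫ _ in (0 : ℝ)..2 * π, C = 2 * π * C := by simp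
  rw [← this]
  refine intervalIntegral.integral_mono_on (by positivity) (Continuous.intervalIntegrable ?_ _ _)
    (by simp) fun θ _ => ?_
  · exact continuous_comp_mul hT.continuous hT.vanish (hv.continuous_circle r) fun θ h =>
      ((hv.continuousAt_fderiv_circle h).clm_apply continuous_unitVec.continuousAt).div
        (hv.continuousAt_areaElement_circle h) (areaElement_pos _ _).ne'
  · refine le_trans (mul_le_of_le_one_right (hT0 _) ?_) (hC θ)
    rw [div_le_one (areaElement_pos _ _)]
    exact (le_abs_self _).trans (abs_fderiv_unitVec_le _ _ _)

/-- The flux of a truncation that is positive somewhere, but not everywhere, is eventually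
positive. -/
theorem exists_flux_pos (hv : IsPositiveMinimal v) (ha : 0 < a) {x y : E2} (hx : 2 * a < v x)
    (hy : v y ≤ 2 * a) : ∃ r : ℝ, 0 < r ∧ 0 < flux (excessSq a) v r := by
  by_contra! hcon
  have hE := isTruncation_excessSq ha
  have hz : ∀ r : ℝ, 0 < r → flux (excessSq a) v r = 0 := fun r hr =>
    le_antisymm (hcon r hr) (hv.flux_nonneg hE (excessSqDeriv_nonneg a) hr.le)
  set P : E2 → ℝ := fun z => excessSqDeriv a (v z) * energyDensity v z with hP
  have hPc : Continuous P := continuous_comp_mul hE.continuous_deriv hE.vanish_deriv hv.continuous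
    fun z hz => hv.continuousAt_energyDensity hz
  have hP0 : ∀ z, 0 ≤ P z := fun z => mul_nonneg (excessSqDeriv_nonneg a _) (energyDensity_nonneg v z)
  have hcirc : ∀ r : ℝ, 0 < r → ∀ θ ∈ Set.Icc 0 (2 * π), P (r • unitVec θ) = 0 := by
    intro r hr θ hθ
    by_contra hne
    have hd : fluxDeriv (excessSqDeriv a) v r = 0 := by
      refine (hv.hasDerivAt_flux hE r).unique ?_
      refine (hasDerivAt_const r (0 : ℝ)).congr_of_eventuallyEq ?_
      filter_upwards [eventually_gt_nhds hr] with s hs using hz s hs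
    have : 0 < ∫ θ in (0 : ℝ)..2 * π, P (r • unitVec θ) :=
      intervalIntegral.integral_pos (by positivity)
        (hPc.comp (continuous_unitVec.const_smul r)).continuousOn (fun _ _ => hP0 _)
        ⟨θ, hθ, (hP0 _).lt_of_ne' hne⟩
    exact (mul_pos hr this).ne' hd
  have hPne : ∀ z ≠ 0, P z = 0 := by
    intro z hz
    obtain ⟨θ, hθ⟩ := exists_eq_smul_unitVec z
    obtain ⟨t, ht, hte⟩ := unitVec_periodic.exists_mem_Ico₀ two_pi_pos θ
    rw [hθ, hte]
    exact hcirc _ (norm_pos_iff.2 hz) t (Set.Ico_subset_Icc_self ht)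
  have hPz : P = fun _ => 0 := by
    refine Continuous.ext_on (dense_compl_singleton (0 : E2)) hPc continuous_const fun z hz => ?_
    exact hPne z hz
  have hdiff : ∀ z, HasFDerivAt (fun z => excessSq a (v z)) (0 : E2 →L[ℝ] ℝ) z := by
    intro z
    rcases lt_or_ge 0 (v z) with h | h
    · have h1 : HasFDerivAt (fun z => excessSq a (v z)) (excessSqDeriv a (v z) • fderiv ℝ v z) z :=
        (hE.hasDerivAt (v z)).comp_hasFDerivAt z
          ((hv.contDiffAt z h).differentiableAt two_ne_zero).hasFDerivAt
      convert h1 using 1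
      rcases mul_eq_zero.1 (congrFun hPz z) with h2 | h2
      · rw [h2, zero_smul]
      · rw [energyDensity, _root_.div_eq_zero_iff, or_iff_left (areaElement_pos v z).ne'] at h2
        have hpx : partialX v z = 0 := by nlinarith [sq_nonneg (partialX v z), sq_nonneg (partialY v z)]
        have hpy : partialY v z = 0 := by nlinarith [sq_nonneg (partialX v z), sq_nonneg (partialY v z)]
        have : fderiv ℝ v z = 0 := by
          ext w
          have hw : w = w 0 • EuclideanSpace.single 0 1 + w 1 • EuclideanSpace.single 1 1 := by
            ext i
            fin_cases i <;> simp
          rw [hw, map_add, map_smul, map_smul]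
          change w 0 • partialX v z + w 1 • partialY v z = _
          simp [hpx, hpy]
        rw [this, smul_zero]
    · have hlt : ∀ᶠ t in nhds z, v t < 2 * a :=
        hv.continuous.continuousAt.eventually_lt_const (h.trans_lt (by positivity))
      refine (hasFDerivAt_const (0 : ℝ) z).congr_of_eventuallyEq ?_
      filter_upwards [hlt] with t ht
      rw [excessSq, max_eq_right (by linarith)]
      simp
  have hconst := is_const_of_fderiv_eq_zero (𝕜 := ℝ) (fun z => (hdiff z).differentiableAt)
    (fun z => (hdiff z).fderiv) x y
  simp only [excessSq] at hconst
  rw [max_eq_right (by linarith : v y - 2 * a ≤ 0), max_eq_left (by linarith)] at hconst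
  nlinarith

end IsPositiveMinimal

/-! ### The growth comparison -/

/-- Three fluxes satisfying the differential inequality cannot all grow at most cubically when the
weighted lengths are, on average, bounded by the length of the circle. -/
theorem not_three_fluxes {F F' K K' A : Fin 3 → ℝ → ℝ} {r₀ C : ℝ} (hr₀ : 0 < r₀)
    (hF : ∀ i, ∀ r ≥ r₀, HasDerivAt (F i) (F' i r) r)
    (hK : ∀ i, ∀ r ≥ r₀, HasDerivAt (K i) (K' i r) r)
    (hF0 : ∀ i, ∀ r ≥ r₀, 0 < F i r) (hF'0 : ∀ i, ∀ r ≥ r₀, 0 ≤ F' i r)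
    (hA0 : ∀ i, ∀ r ≥ r₀, 0 ≤ A i r)
    (hFA : ∀ i, ∀ r ≥ r₀, 128 * F i r ^ 2 ≤ 3 * (A i r ^ 2 * F' i r ^ 2))
    (hA : ∀ r ≥ r₀, ∑ i, A i r ≤ 2 * π * r + ∑ i, K' i r)
    (hKle : ∀ i, ∀ r ≥ r₀, K i r ≤ π / 250 * r ^ 2)
    (hFle : ∀ i, ∀ r ≥ r₀, F i r ≤ C * r ^ 3) : False := by
  set c : ℝ := 6.53 with hc
  have hπ' := pi_lt_d4
  have hπ0 := pi_pos
  set κ : ℝ := 9 * c / (4 * π ^ 2) with hκ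
  have hκ0 : 0 < κ := by positivity
  have hκπ : 9.35 / (2 * π) ≤ κ := by
    rw [hκ, div_le_div_iff₀ (by positivity) (by positivity), hc]
    nlinarith [mul_pos hπ0 (sub_pos.2 hπ')]
  set Ψ : ℝ → ℝ := fun r => ∑ i, K i r
  set Z : ℝ → ℝ := fun r => ∑ i, log (F i r) + κ * (Ψ r / r ^ 2) - 9.05 * log r
  have hΨle : ∀ r ≥ r₀, Ψ r ≤ 3 * (π / 250 * r ^ 2) := fun r hr => by
    have := Finset.sum_le_sum fun i (_ : i ∈ Finset.univ) => hKle i r hr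
    simpa using this
  have hZd : ∀ r ≥ r₀, HasDerivAt Z (∑ i, F' i r / F i r +
      κ * ((∑ i, K' i r) / r ^ 2 - 2 * Ψ r / r ^ 3) - 9.05 / r) r := by
    intro r hr
    have hr0 : 0 < r := hr₀.trans_le hr
    have h1 : HasDerivAt (fun r => ∑ i, log (F i r)) (∑ i, F' i r / F i r) r :=
      HasDerivAt.fun_sum fun i _ => (hF i r hr).log (hF0 i r hr).ne'
    have h2 : HasDerivAt Ψ (∑ i, K' i r) r := HasDerivAt.fun_sum fun i _ => hK i r hr
    have h3 := (h2.div (hasDerivAt_pow 2 r) (by positivity)).const_mul κ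
    have h4 := (Real.hasDerivAt_log hr0.ne').const_mul 9.05
    refine ((h1.add h3).sub h4).congr_deriv ?_
    simp only [Nat.cast_ofNat, Nat.add_one_sub_one, pow_one]
    field_simp
  have hZ' : ∀ r ≥ r₀, 0 ≤ ∑ i, F' i r / F i r +
      κ * ((∑ i, K' i r) / r ^ 2 - 2 * Ψ r / r ^ 3) - 9.05 / r := by
    intro r hr
    have hr0 : 0 < r := hr₀.trans_le hr
    set t := 2 * π * r / 3 with ht
    have ht0 : 0 < t := by positivity
    have hi : ∀ i, c * ((2 * t - A i r) / t ^ 2) ≤ F' i r / F i r := by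
      intro i
      have hFi := hF0 i r hr
      have hAF : c * F i r ≤ A i r * F' i r := by
        refine abs_le_of_sq_le_sq' ?_ (mul_nonneg (hA0 i r hr) (hF'0 i r hr)) |>.2
        have := hFA i r hr
        rw [mul_pow, mul_pow, hc]
        nlinarith [sq_nonneg (F i r)]
      have hAi : 0 < A i r := by
        refine (hA0 i r hr).lt_of_ne' fun h => ?_
        rw [h, zero_mul] at hAF
        have : 0 < c * F i r := by positivity
        linarith
      have h1 : (2 * t - A i r) / t ^ 2 ≤ 1 / A i r := by
        rw [div_le_div_iff₀ (by positivity) hAi]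
        nlinarith [sq_nonneg (t - A i r)]
      calc c * ((2 * t - A i r) / t ^ 2) ≤ c * (1 / A i r) := by gcongr
        _ ≤ F' i r / F i r := by
          rw [mul_one_div, div_le_div_iff₀ hAi hFi]
          linarith
    have hs := Finset.sum_le_sum fun i (_ : i ∈ Finset.univ) => hi i
    have hs2 : ∑ i, c * ((2 * t - A i r) / t ^ 2) = c * ((6 * t - ∑ i, A i r) / t ^ 2) := by
      simp only [Fin.sum_univ_three]
      ring
    rw [hs2] at hs
    have h3 : κ * ((2 * π * r - ∑ i, K' i r) / r ^ 2) ≤ ∑ i, F' i r / F i r := by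
      refine le_trans ?_ hs
      have : κ * ((2 * π * r - ∑ i, K' i r) / r ^ 2) =
          c * ((2 * π * r - ∑ i, K' i r) / t ^ 2) := by
        rw [hκ, ht]
        field_simp
        ring
      rw [this]
      have := hA r hr
      refine mul_le_mul_of_nonneg_left (div_le_div_of_nonneg_right ?_ (by positivity))
        (by norm_num [hc])
      rw [ht]
      linarith
    have h4 : κ * ((2 * π * r - ∑ i, K' i r) / r ^ 2) + κ * ((∑ i, K' i r) / r ^ 2) =
        κ * (2 * π) / r := by
      field_simp
      ring
    have h5 : κ * (2 * Ψ r / r ^ 3) ≤ κ * (2 * π) * (3 / 250) / r := by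
      have : 2 * Ψ r / r ^ 3 ≤ 2 * (3 * (π / 250 * r ^ 2)) / r ^ 3 := by
        have := hΨle r hr
        gcongr
      refine (mul_le_mul_of_nonneg_left this hκ0.le).trans_eq ?_
      field_simp
    have h6 : 9.05 / r ≤ κ * (2 * π) * (1 - 3 / 250) / r := by
      gcongr
      have : 9.35 ≤ κ * (2 * π) := by rwa [div_le_iff₀ (by positivity)] at hκπ
      linarith
    have h7 : κ * (2 * π) * (1 - 3 / 250) / r =
      κ * (2 * π) / r - κ * (2 * π) * (3 / 250) / r := by ring
    rw [mul_sub]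
    linarith
  have hmono : MonotoneOn Z (Set.Ici r₀) := by
    refine monotoneOn_of_deriv_nonneg (convex_Ici r₀)
      (fun r hr => (hZd r hr).continuousAt.continuousWithinAt) (fun r hr => ?_) fun r hr => ?_
    · exact (hZd r (interior_subset hr)).differentiableAt.differentiableWithinAt
    · rw [(hZd r (interior_subset hr)).deriv]
      exact hZ' r (interior_subset hr)
  have hC : 0 < C := by
    have := (hF0 0 r₀ le_rfl).trans_le (hFle 0 r₀ le_rfl)
    exact pos_of_mul_pos_left this (by positivity)
  have hbound : ∀ r ≥ r₀, 0.05 * log r ≤ 3 * log C + κ * (3 * (π / 250)) - Z r₀ := by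
    intro r hr
    have hr0 : 0 < r := hr₀.trans_le hr
    have h1 := hmono (Set.self_mem_Ici) hr hr
    have h2 : ∑ i, log (F i r) ≤ 3 * (log C + 3 * log r) := by
      have : ∀ i, log (F i r) ≤ log C + 3 * log r := fun i => by
        have := Real.log_le_log (hF0 i r hr) (hFle i r hr)
        rwa [Real.log_mul hC.ne' (by positivity), Real.log_pow, Nat.cast_ofNat] at this
      have := Finset.sum_le_sum fun i (_ : i ∈ Finset.univ) => this i
      simpa [mul_add] using this
    have h3 : Ψ r / r ^ 2 ≤ 3 * (π / 250) := by
      rw [div_le_iff₀ (by positivity)]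
      linarith [hΨle r hr]
    have h4 := mul_le_mul_of_nonneg_left h3 hκ0.le
    have h5 : Z r = ∑ i, log (F i r) + κ * (Ψ r / r ^ 2) - 9.05 * log r := rfl
    linarith
  have hlim := Real.tendsto_log_atTop.const_mul_atTop (by norm_num : (0 : ℝ) < 0.05)
  obtain ⟨r, hr1, hr2⟩ := ((Filter.tendsto_atTop.1 hlim
    (3 * log C + κ * (3 * (π / 250)) - Z r₀ + 1)).and (Filter.eventually_ge_atTop r₀)).exists
  linarith [hbound r hr2]

/-- Three disjointly supported positive minimal graphs cannot all have sublinear growth. -/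
theorem not_three_positive_minimal {v : Fin 3 → E2 → ℝ} (hv : ∀ i, IsPositiveMinimal (v i))
    (hdisj : ∀ i j, i ≠ j → ∀ x, 0 < v i x → v j x ≤ 0) (hpos : ∀ i, ∃ x, 0 < v i x)
    (hsub : ∀ i, ∀ ε > 0, ∃ M : ℝ, ∀ x, M ≤ ‖x‖ → v i x ≤ ε * ‖x‖) : False := by
  choose p hp using hpos
  choose M hM using fun i => hsub i (1 / 500) (by norm_num)
  obtain ⟨a, ha, hap⟩ : ∃ a > 0, ∀ i, 2 * a < v i (p i) := by
    obtain ⟨i₀, hi₀⟩ := Finite.exists_min fun i => v i (p i)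
    exact ⟨v i₀ (p i₀) / 3, by linarith [hp i₀], fun i => by linarith [hp i₀, hi₀ i]⟩
  have hE := isTruncation_excessSq ha
  have hT := isTruncation_cutoffPrimitive ha
  have hother : ∀ i : Fin 3, ∃ j, j ≠ i := fun i => exists_ne i
  have hfl : ∀ i, ∃ r : ℝ, 0 < r ∧ 0 < flux (excessSq a) (v i) r := by
    intro i
    obtain ⟨j, hj⟩ := hother i
    exact (hv i).exists_flux_pos ha (hap i) ((hdisj j i hj _ (hp j)).trans (by positivity))
  choose ρ hρ hρF using hfl
  set r₀ : ℝ := 1 + ∑ i, (ρ i + |M i|) with hr₀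
  have hle : ∀ i, ρ i + |M i| ≤ r₀ := fun i => by
    have := Finset.single_le_sum (f := fun i => ρ i + |M i|)
      (fun i _ => add_nonneg (hρ i).le (abs_nonneg _)) (Finset.mem_univ i)
    linarith
  have hr₀0 : 0 < r₀ := by
    have := hle 0
    have := hρ 0
    have := abs_nonneg (M 0)
    linarith
  have hgrow : ∀ i, ∀ r ≥ r₀, ∀ θ, v i (r • unitVec θ) ≤ 1 / 500 * r := by
    intro i r hr θ
    have hn : ‖r • unitVec θ‖ = r := by
      rw [norm_smul, norm_unitVec, mul_one, Real.norm_of_nonneg (hr₀0.le.trans hr)]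
    have := hM i (r • unitVec θ) (by
      rw [hn]
      linarith [hle i, hρ i, le_abs_self (M i)])
    rwa [hn] at this
  have hFpos : ∀ i, ∀ r ≥ r₀, 0 < flux (excessSq a) (v i) r := fun i r hr =>
    (hρF i).trans_le ((hv i).monotoneOn_flux hE (excessSqDeriv_nonneg a) (hρ i).le
      (hr₀0.le.trans hr) (by linarith [hle i, abs_nonneg (M i)]))
  have hzero : ∀ i, ∀ r ≥ r₀, ∃ θ, v i (r • unitVec θ) ≤ 2 * a := by
    intro i r hr
    obtain ⟨j, hj⟩ := hother i
    by_contra! hcon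
    have hFj : flux (excessSq a) (v j) r = 0 := by
      have : ∀ θ, excessSq a (v j (r • unitVec θ)) = 0 := fun θ => by
        have := hdisj i j hj.symm _ (lt_trans (by positivity) (hcon θ))
        rw [excessSq, max_eq_right (by linarith)]
        simp
      simp [flux, this]
    exact (hFpos j r hr).ne' hFj
  refine not_three_fluxes (F := fun i => flux (excessSq a) (v i))
    (F' := fun i => fluxDeriv (excessSqDeriv a) (v i)) (K := fun i => flux (cutoffPrimitive a) (v i))
    (K' := fun i => fluxDeriv (cutoff a) (v i)) (A := fun i => weightedLength (cutoff a) (v i))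
    (C := 2 * π * (1 / 500) ^ 2) hr₀0
    (fun i r _ => (hv i).hasDerivAt_flux hE r) (fun i r _ => (hv i).hasDerivAt_flux hT r) hFpos
    (fun i r hr => IsPositiveMinimal.fluxDeriv_nonneg (hr₀0.le.trans hr) (excessSqDeriv_nonneg a))
    (fun i r hr => IsPositiveMinimal.weightedLength_nonneg (hr₀0.le.trans hr) (cutoff_nonneg ha))
    ?_ ?_ ?_ ?_
  · intro i r hr
    obtain ⟨θ, hθ⟩ := hzero i r hr
    exact (hv i).flux_sq_le ha hθ
  · intro r hr
    have hc1 : ∀ i, Continuous fun θ => cutoff a (v i (r • unitVec θ)) *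
        areaElement (v i) (r • unitVec θ) := fun i =>
      continuous_comp_mul hT.continuous_deriv hT.vanish_deriv ((hv i).continuous_circle r)
        fun θ h => (hv i).continuousAt_areaElement_circle h
    have hc2 : ∀ i, Continuous fun θ => cutoff a (v i (r • unitVec θ)) *
        energyDensity (v i) (r • unitVec θ) := fun i =>
      continuous_comp_mul hT.continuous_deriv hT.vanish_deriv ((hv i).continuous_circle r)
        fun θ h => (hv i).continuousAt_energyDensity_circle h
    have hcut : ∀ x, ∑ i, cutoff a (v i x) ≤ 1 := by
      intro x
      by_cases h : ∃ i, 0 < v i x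
      · obtain ⟨i, hi⟩ := h
        rw [Finset.sum_eq_single i (fun j _ hj => cutoff_of_nonpos ha (hdisj i j hj.symm x hi))
          (by simp)]
        exact cutoff_le_one ha _
      · push Not at h
        rw [Finset.sum_eq_zero fun i _ => cutoff_of_nonpos ha (h i)]
        exact zero_le_one
    simp only [weightedLength, fluxDeriv]
    rw [← Finset.mul_sum, ← Finset.mul_sum,
      ← intervalIntegral.integral_finsetSum fun i _ => (hc1 i).intervalIntegrable _ _,
      ← intervalIntegral.integral_finsetSum fun i _ => (hc2 i).intervalIntegrable _ _]
    have h1 : 2 * π * r = r * ∫ _ in (0 : ℝ)..2 * π, (1 : ℝ) := by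
      simp
      ring
    rw [h1, ← mul_add, ← intervalIntegral.integral_add (by simp)
      (Continuous.intervalIntegrable (continuous_finsetSum _ fun i _ => hc2 i) _ _)]
    refine mul_le_mul_of_nonneg_left ?_ (hr₀0.le.trans hr)
    refine intervalIntegral.integral_mono_on (by positivity)
      (Continuous.intervalIntegrable (continuous_finsetSum _ fun i _ => hc1 i) _ _)
      (Continuous.intervalIntegrable
        (continuous_const.add (continuous_finsetSum _ fun i _ => hc2 i)) _ _) fun θ _ => ?_
    refine le_trans ?_ (add_le_add_left (hcut (r • unitVec θ)) _)
    rw [← Finset.sum_add_distrib]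
    refine Finset.sum_le_sum fun i _ => ?_
    have := mul_le_mul_of_nonneg_left (areaElement_le (v i) (r • unitVec θ))
      (cutoff_nonneg ha (v i (r • unitVec θ)))
    linarith
  · intro i r hr
    refine ((hv i).flux_le hT (cutoffPrimitive_nonneg ha) (hr₀0.le.trans hr)
      (C := 1 / 500 * r) fun θ => ?_).trans_eq (by ring)
    exact (cutoffPrimitive_le ha ((hv i).nonneg _)).trans (hgrow i r hr θ)
  · intro i r hr
    refine ((hv i).flux_le hE (excessSq_nonneg a) (hr₀0.le.trans hr)
      (C := (1 / 500 * r) ^ 2) fun θ => ?_).trans_eq (by ring)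
    exact (excessSq_le ha ((hv i).nonneg _)).trans
      (pow_le_pow_left₀ ((hv i).nonneg _) (hgrow i r hr θ) 2)

theorem msDiv_congr {u v : E2 → ℝ} {x : E2} (h : u =ᶠ[nhds x] v) : msDiv u x = msDiv v x := by
  have hg : gradient u =ᶠ[nhds x] gradient v := by
    filter_upwards [h.eventuallyEq_nhds] with y hy
    rw [gradient, gradient, hy.fderiv_eq]
  unfold msDiv
  refine Finset.sum_congr rfl fun i _ => ?_
  congr 1
  refine Filter.EventuallyEq.fderiv_eq ?_
  filter_upwards [hg] with y hy
  rw [hy]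

/-- The extension by zero of a supported minimal graph. -/
theorem isPositiveMinimal_indicator {Ω : Set E2} {u : E2 → ℝ} (hopen : IsOpen Ω)
    (hsmooth : ContDiffOn ℝ (⊤ : ℕ∞) u Ω) (hmse : ∀ x ∈ Ω, msDiv u x = 0)
    (hnonneg : ∀ x ∈ Ω, 0 ≤ u x) (hcont : ContinuousOn u (closure Ω))
    (hbdry : ∀ x ∈ frontier Ω, u x = 0) : IsPositiveMinimal (Ω.indicator u) := by
  have hmem : ∀ x, 0 < Ω.indicator u x → x ∈ Ω := fun x hx =>
    Set.mem_of_indicator_ne_zero hx.ne'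
  have heq : ∀ x ∈ Ω, Ω.indicator u =ᶠ[nhds x] u := fun x hx => by
    filter_upwards [hopen.mem_nhds hx] with y hy
    exact Set.indicator_of_mem hy u
  refine ⟨?_, Set.indicator_nonneg hnonneg, fun x hx => ?_, fun x hx => ?_⟩
  · classical
    rw [← Set.piecewise_eq_indicator]
    exact continuous_piecewise hbdry hcont continuousOn_const
  · have h := hsmooth.contDiffAt (hopen.mem_nhds (hmem x hx))
    exact (h.of_le (WithTop.coe_le_coe.2 le_top)).congr_of_eventuallyEq (heq x (hmem x hx))
  · rw [msDiv_congr (heq x (hmem x hx))]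
    exact hmse x (hmem x hx)

/-- **Meeks' conjecture for sub-linear growth.**
If `(Ω₁,u₁),…,(Ω_k,u_k)` are disjointly supported minimal graphs in `ℝ³` and each graph has
sub-linear growth, i.e. `u_i(x)/|x| → 0` as `|x| → ∞` in `Ω_i`, then `k ≤ 2`. -/
theorem disjoint_minimal_graphs_sublinear_growth
    (k : ℕ) (Ω : Fin k → Set E2) (u : Fin k → E2 → ℝ)
    (hopen : ∀ i, IsOpen (Ω i))
    (hdisj : Pairwise fun i j => Disjoint (Ω i) (Ω j))
    (hsmooth : ∀ i, ContDiffOn ℝ (⊤ : ℕ∞) (u i) (Ω i))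
    (hmse : ∀ i, ∀ x ∈ Ω i, msDiv (u i) x = 0)
    (hnonneg : ∀ i, ∀ x ∈ Ω i, 0 ≤ u i x)
    (hcont : ∀ i, ContinuousOn (u i) (closure (Ω i)))
    (hbdry : ∀ i, ∀ x ∈ frontier (Ω i), u i x = 0)
    (hnontrivial : ∀ i, ∃ x ∈ Ω i, u i x ≠ 0)
    (hsublinear : ∀ i, ∀ ε > 0, ∃ M : ℝ, ∀ x ∈ Ω i, M ≤ ‖x‖ → u i x / ‖x‖ < ε) :
    k ≤ 2 := by
  by_contra! hk
  let φ : Fin 3 ↪ Fin k := Fin.castLEEmb hk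
  refine not_three_positive_minimal (v := fun i => (Ω (φ i)).indicator (u (φ i)))
    (fun i => isPositiveMinimal_indicator (hopen _) (hsmooth _) (hmse _) (hnonneg _) (hcont _)
      (hbdry _)) (fun i j hij x hx => ?_) (fun i => ?_) fun i ε hε => ?_
  · have hxi : x ∈ Ω (φ i) := Set.mem_of_indicator_ne_zero hx.ne'
    have hxj : x ∉ Ω (φ j) := Set.disjoint_left.1 (hdisj (φ.injective.ne hij)) hxi
    exact (Set.indicator_of_notMem hxj _).le
  · obtain ⟨x, hx, hne⟩ := hnontrivial (φ i)
    exact ⟨x, by rw [Set.indicator_of_mem hx]; exact (hnonneg _ x hx).lt_of_ne' hne⟩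
  · obtain ⟨M, hM⟩ := hsublinear (φ i) ε hε
    refine ⟨max M 1, fun x hx => ?_⟩
    have hx0 : 0 < ‖x‖ := one_pos.trans_le ((le_max_right M 1).trans hx)
    by_cases hxi : x ∈ Ω (φ i)
    · have := hM x hxi ((le_max_left M 1).trans hx)
      rw [Set.indicator_of_mem hxi]
      exact ((div_lt_iff₀ hx0).1 this).le
    · rw [Set.indicator_of_notMem hxi]
      positivity
end
end

section
/- Suppose (Ω₁,u₁),…,(Ω_k,u_k) is a family of disjointly supported minimal graphs in ℝ³ (pairwise disjoint open sets Ω_i ⊆ ℝ², each u_i a nonnegative, not identically zero smooth solution of the minimal surface equation vanishing continuously on ∂Ω_i). If there is a constant c ≥ 0 such that |∇u_i(x)| ≤ c for all i and all x ∈ Ω_i, then k ≤ 2√(1+c²). -/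
open Real MeasureTheory ENNReal

noncomputable section

theorem hasDerivAt_integral_of_continuous {f f' : ℝ → ℝ → ℝ} (a b : ℝ)
    (hf : Continuous (Function.uncurry f)) (hf' : Continuous (Function.uncurry f'))
    (hd : ∀ r t, HasDerivAt (fun s => f s t) (f' r t) r) (r : ℝ) :
    HasDerivAt (fun s => ∫ t in a..b, f s t) (∫ t in a..b, f' r t) r := by
  obtain ⟨C, hC⟩ := ((isCompact_Icc (a := r - 1) (b := r + 1)).prod
    (isCompact_uIcc (a := a) (b := b))).exists_bound_of_continuousOn hf'.continuousOn
  refine (intervalIntegral.hasDerivAt_integral_of_dominated_loc_of_deriv_le (F := f) (F' := f')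
    (s := Set.Icc (r - 1) (r + 1)) (bound := fun _ => C)
    (Icc_mem_nhds (by linarith) (by linarith)) ?_ ?_ ?_ ?_ ?_ ?_).2
  · exact Filter.Eventually.of_forall fun s =>
      (show Continuous (f s) by fun_prop).aestronglyMeasurable
  · exact (show Continuous (f r) by fun_prop).intervalIntegrable _ _
  · exact (show Continuous (f' r) by fun_prop).aestronglyMeasurable
  · exact Filter.Eventually.of_forall fun t ht s hs =>
      hC (s, t) ⟨hs, Set.uIoc_subset_uIcc ht⟩
  · exact intervalIntegrable_const
  · exact Filter.Eventually.of_forall fun t _ s _ => hd s t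

/-- Measure of the positivity set of `f` on `[a, x]`. -/
def posLength (f : ℝ → ℝ) (a x : ℝ) : ℝ :=
  ∫ t in a..x, Set.indicator {t | 0 < f t} (fun _ => (1 : ℝ)) t

theorem intervalIntegrable_indicator_pos {f : ℝ → ℝ} (hf : Continuous f) (a b : ℝ) :
    IntervalIntegrable (Set.indicator {t | 0 < f t} (fun _ => (1 : ℝ))) volume a b := by
  have hS : MeasurableSet {t | 0 < f t} := (isOpen_lt continuous_const hf).measurableSet
  rw [intervalIntegrable_iff]
  exact (integrableOn_const (by simp)).indicator hS

/-- Wirtinger's inequality on a circle for a nonnegative function with a zero, in terms of the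
length of its positivity set; the sharp constant `π` is replaced by `3`. -/
theorem wirtinger_posLength {f f' : ℝ → ℝ} {T l a : ℝ} (hT : 0 ≤ T)
    (hf : ∀ x, HasDerivAt f (f' x) x) (hf' : Continuous f') (hnn : ∀ x, 0 ≤ f x)
    (hper : Function.Periodic f T) (ha : f a = 0) (hl : 0 ≤ l) (hl3 : l * posLength f 0 T ≤ 3) :
    l ^ 2 * ∫ x in (0)..T, f x ^ 2 ≤ ∫ x in (0)..T, f' x ^ 2 := by
  have hfc : Continuous f := continuous_iff_continuousAt.2 fun x => (hf x).continuousAt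
  have hper' : Function.Periodic f' T := fun x =>
    (((hf (x + T)).comp_add_const x T).congr_of_eventuallyEq
      (Filter.Eventually.of_forall fun y => (hper y).symm)).unique (hf x)
  set S : Set ℝ := {t | 0 < f t} with hS
  have hSo : IsOpen S := isOpen_lt continuous_const hfc
  set q := posLength f 0 T with hq
  have hqa : posLength f a (a + T) = q := by
    have : Function.Periodic (Set.indicator S (fun _ => (1 : ℝ))) T := fun x => by
      simp [Set.indicator, hS, hper x]
    simpa [hq, posLength] using this.intervalIntegral_add_eq a 0
  have hint := fun b c => intervalIntegrable_indicator_pos hfc b c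
  set p := posLength f a with hp
  have hpc : Continuous p := intervalIntegral.continuous_primitive hint a
  have hpd : ∀ x ∈ S, HasDerivAt p 1 x := fun x hx => by
    have hev : Set.indicator S (fun _ => (1 : ℝ)) =ᶠ[nhds x] fun _ => 1 := by
      filter_upwards [hSo.mem_nhds hx] with y hy using Set.indicator_of_mem hy _
    have := intervalIntegral.integral_hasDerivAt_right (hint a x)
      ((measurable_const.indicator hSo.measurableSet).stronglyMeasurable.stronglyMeasurableAtFilter)
      ((continuousAt_const.congr hev.symm))
    rwa [hev.eq_of_nhds] at this
  have hp_mem : ∀ x ∈ Set.Icc a (a + T), 0 ≤ p x ∧ p x ≤ q := fun x hx => by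
    have hnn' : ∀ t, 0 ≤ Set.indicator S (fun _ => (1 : ℝ)) t := fun t =>
      Set.indicator_nonneg (fun _ _ => zero_le_one) t
    refine ⟨intervalIntegral.integral_nonneg hx.1 fun t _ => hnn' t, ?_⟩
    rw [← hqa]
    exact intervalIntegral.integral_mono_interval le_rfl hx.1 hx.2
      (Filter.Eventually.of_forall hnn') (hint _ _)
  set w : ℝ → ℝ := fun x => l * (p x - q / 2) with hw
  have hwc : Continuous w := by fun_prop
  have hcos : ∀ x ∈ Set.Icc a (a + T), 0 < cos (w x) := fun x hx => by
    obtain ⟨h1, h2⟩ := hp_mem x hx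
    have := Real.pi_gt_three
    apply Real.cos_pos_of_mem_Ioo
    constructor <;> simp only [hw] <;> nlinarith
  set H : ℝ → ℝ := fun x => l * f x ^ 2 * tan (w x) with hH
  set H' : ℝ → ℝ := fun x => l * (2 * f x * f' x) * tan (w x) +
    l ^ 2 * f x ^ 2 * (1 + tan (w x) ^ 2) with hH'
  have htan : ContinuousOn (fun x => tan (w x)) (Set.Icc a (a + T)) := fun x hx =>
    ((Real.continuousAt_tan.2 (hcos x hx).ne').comp hwc.continuousAt).continuousWithinAt
  have hHd : ∀ x ∈ Set.Icc a (a + T), HasDerivAt H (H' x) x := fun x hx => by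
    by_cases hxS : x ∈ S
    · have h1 : HasDerivAt w l x := by
        simpa using ((hpd x hxS).sub_const (q / 2)).const_mul l
      have h2 := (((hf x).pow 2).const_mul l).mul
        ((Real.hasDerivAt_tan (hcos x hx).ne').comp x h1)
      have h3 : 1 / cos (w x) ^ 2 = 1 + tan (w x) ^ 2 := by
        have := (hcos x hx).ne'
        rw [Real.tan_eq_sin_div_cos]
        field_simp
        rw [Real.cos_sq_add_sin_sq]
      rw [h3] at h2
      refine h2.congr_deriv ?_
      change l * ((2 : ℕ) * f x ^ 1 * f' x) * tan (w x) +
        l * f x ^ 2 * ((1 + tan (w x) ^ 2) * l) = _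
      simp only [hH']
      push_cast
      ring
    · have hfx : f x = 0 := le_antisymm (not_lt.1 hxS) (hnn x)
      have : H' x = 0 := by simp [hH', hfx]
      rw [this]
      have hO : (fun y => f y) =O[nhds x] fun y => y - x := by
        simpa [hfx] using (hf x).isBigO_sub
      have ho : (fun y => f y) =o[nhds x] fun _ => (1 : ℝ) := by
        rw [Asymptotics.isLittleO_one_iff]
        simpa [hfx] using hfc.tendsto x
      have hb : (fun y => l * tan (w y)) =O[nhds x] fun _ => (1 : ℝ) :=
        (continuousAt_const.mul ((Real.continuousAt_tan.2 (hcos x hx).ne').comp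
          hwc.continuousAt)).isBigO_one ℝ
      rw [hasDerivAt_iff_isLittleO]
      have := (hb.mul_isLittleO (hO.mul_isLittleO ho))
      simp only [hH, hfx]
      refine this.congr (fun y => ?_) (fun y => ?_)
      · simp
        ring
      · simp
  have hH'c : ContinuousOn H' (Set.uIcc a (a + T)) := by
    rw [Set.uIcc_of_le (by linarith)]
    simp only [hH']
    fun_prop
  have hFTC : ∫ x in a..(a + T), H' x = 0 := by
    rw [intervalIntegral.integral_eq_sub_of_hasDerivAt (f := H)
      (fun x hx => hHd x (by rwa [Set.uIcc_of_le (by linarith)] at hx)) hH'c.intervalIntegrable]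
    simp [hH, hper a, ha]
  have key : ∫ x in a..(a + T), (l ^ 2 * f x ^ 2 - H' x) ≤ ∫ x in a..(a + T), f' x ^ 2 := by
    refine intervalIntegral.integral_mono_on (by linarith)
      (((show Continuous fun x => l ^ 2 * f x ^ 2 by fun_prop).intervalIntegrable _ _).sub
        hH'c.intervalIntegrable) ((hf'.pow 2).intervalIntegrable _ _) fun x hx => ?_
    simp only [hH']
    nlinarith [sq_nonneg (f' x + l * f x * tan (w x))]
  rw [intervalIntegral.integral_sub
    ((show Continuous fun x => l ^ 2 * f x ^ 2 by fun_prop).intervalIntegrable _ _)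
    hH'c.intervalIntegrable, hFTC, sub_zero, intervalIntegral.integral_const_mul] at key
  have e1 := (show Function.Periodic (fun x => f x ^ 2) T from
    fun x => by simp [hper x]).intervalIntegral_add_eq a 0
  have e2 := (show Function.Periodic (fun x => f' x ^ 2) T from
    fun x => by simp [hper' x]).intervalIntegral_add_eq a 0
  rw [zero_add] at e1 e2
  rwa [e1, e2] at key

/-- The partial derivative of `f` in the direction of the `i`-th coordinate. -/
def pderivE (f : E2 → ℝ) (i : Fin 2) (x : E2) : ℝ :=
  fderiv ℝ f x (EuclideanSpace.single i 1)

def radialDir (t : ℝ) : E2 :=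
  cos t • EuclideanSpace.single 0 1 + sin t • EuclideanSpace.single 1 1

def angularDir (t : ℝ) : E2 :=
  -sin t • EuclideanSpace.single 0 1 + cos t • EuclideanSpace.single 1 1

theorem hasDerivAt_radialDir (t : ℝ) : HasDerivAt radialDir (angularDir t) t :=
  ((Real.hasDerivAt_cos t).smul_const _).add ((Real.hasDerivAt_sin t).smul_const _)

@[fun_prop]
theorem continuous_radialDir : Continuous radialDir := by
  unfold radialDir
  fun_prop

@[fun_prop]
theorem continuous_pderivE {f : E2 → ℝ} (hf : ContDiff ℝ 1 f) (i : Fin 2) :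
    Continuous (pderivE f i) :=
  (hf.continuous_fderiv one_ne_zero).clm_apply continuous_const

theorem radialDir_periodic : Function.Periodic radialDir (2 * π) := fun t => by
  simp [radialDir]

theorem exists_eq_smul_radialDir (x : E2) : ∃ r t : ℝ, 0 ≤ r ∧ 0 ≤ t ∧ t < 2 * π ∧
    x = r • radialDir t := by
  have hx : x = x 0 • EuclideanSpace.single 0 1 + x 1 • EuclideanSpace.single 1 1 := by
    ext i; fin_cases i <;> simp
  set z : ℂ := ⟨x 0, x 1⟩ with hz
  obtain ⟨t, ht, hte⟩ := radialDir_periodic.exists_mem_Ico₀ Real.two_pi_pos z.arg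
  refine ⟨‖z‖, t, norm_nonneg _, ht.1, ht.2, ?_⟩
  rw [← hte, radialDir, smul_add, smul_smul, smul_smul, Complex.norm_mul_cos_arg,
    Complex.norm_mul_sin_arg]
  exact hx

theorem hasDerivAt_smul_radialDir_left {f : E2 → ℝ} (hf : ContDiff ℝ 1 f) (r t : ℝ) :
    HasDerivAt (fun s => f (s • radialDir t))
      (cos t * pderivE f 0 (r • radialDir t) + sin t * pderivE f 1 (r • radialDir t)) r := by
  have h := ((hf.differentiable one_ne_zero (r • radialDir t)).hasFDerivAt).comp_hasDerivAt r
    ((hasDerivAt_id r).smul_const (radialDir t))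
  refine h.congr_deriv ?_
  rw [one_smul]
  simp only [radialDir, map_add, map_smul, smul_eq_mul, pderivE]

theorem hasDerivAt_smul_radialDir_right {f : E2 → ℝ} (hf : ContDiff ℝ 1 f) (r t : ℝ) :
    HasDerivAt (fun s => f (r • radialDir s))
      (r * (-sin t * pderivE f 0 (r • radialDir t) + cos t * pderivE f 1 (r • radialDir t)))
      t := by
  have h := ((hf.differentiable one_ne_zero (r • radialDir t)).hasFDerivAt).comp_hasDerivAt t
    ((hasDerivAt_radialDir t).const_smul r)
  refine h.congr_deriv ?_
  simp only [angularDir, map_add, map_smul, smul_eq_mul, pderivE]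

/-- The divergence theorem on disks, in differentiated form. -/
theorem hasDerivAt_integral_radial_flux {X : Fin 2 → E2 → ℝ} (hX : ∀ i, ContDiff ℝ 1 (X i))
    (r : ℝ) :
    HasDerivAt (fun s => ∫ t in (0)..(2 * π),
        s * (X 0 (s • radialDir t) * cos t + X 1 (s • radialDir t) * sin t))
      (∫ t in (0)..(2 * π), r * ∑ i, pderivE (X i) i (r • radialDir t)) r := by
  have hc := fun i => (hX i).continuous
  have hp := fun i j => continuous_pderivE (hX i) j
  set F' : ℝ → ℝ → ℝ := fun s t =>
    (X 0 (s • radialDir t) * cos t + X 1 (s • radialDir t) * sin t) +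
    s * ((cos t * pderivE (X 0) 0 (s • radialDir t) +
          sin t * pderivE (X 0) 1 (s • radialDir t)) * cos t +
        (cos t * pderivE (X 1) 0 (s • radialDir t) +
          sin t * pderivE (X 1) 1 (s • radialDir t)) * sin t) with hF'
  have h1 := hasDerivAt_integral_of_continuous
    (f := fun s t => s * (X 0 (s • radialDir t) * cos t + X 1 (s • radialDir t) * sin t))
    (f' := F') 0 (2 * π)
    (by simp only [Function.uncurry_def]; fun_prop)
    (by simp only [hF', Function.uncurry_def]; fun_prop)
    (fun s t => by
      have := (hasDerivAt_id s).mul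
        (((hasDerivAt_smul_radialDir_left (hX 0) s t).mul_const (cos t)).add
          ((hasDerivAt_smul_radialDir_left (hX 1) s t).mul_const (sin t)))
      refine this.congr_deriv ?_
      simp [hF']) r
  refine h1.congr_deriv ?_
  set G : ℝ → ℝ := fun t => -X 0 (r • radialDir t) * sin t + X 1 (r • radialDir t) * cos t with hG
  set G' : ℝ → ℝ := fun t => r * (∑ i, pderivE (X i) i (r • radialDir t)) - F' r t with hG'
  have hGd : ∀ t, HasDerivAt G (G' t) t := fun t => by
    have := ((hasDerivAt_smul_radialDir_right (hX 0) r t).neg.mul (Real.hasDerivAt_sin t)).add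
      ((hasDerivAt_smul_radialDir_right (hX 1) r t).mul (Real.hasDerivAt_cos t))
    refine this.congr_deriv ?_
    simp only [hG', hF', Fin.sum_univ_two, Pi.neg_apply]
    have := Real.sin_sq_add_cos_sq t
    linear_combination (r * pderivE (X 0) 0 (r • radialDir t) +
      r * pderivE (X 1) 1 (r • radialDir t)) * this
  have hsum : Continuous fun t => r * (∑ i, pderivE (X i) i (r • radialDir t)) := by fun_prop
  have hFc : Continuous (F' r) := by simp only [hF']; fun_prop
  have h2 : ∫ t in (0)..(2 * π), G' t = 0 := by
    rw [intervalIntegral.integral_eq_sub_of_hasDerivAt (fun t _ => hGd t)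
      ((hsum.sub hFc).intervalIntegrable _ _)]
    simp [hG, radialDir]
  rw [intervalIntegral.integral_sub (hsum.intervalIntegrable _ _) (hFc.intervalIntegrable _ _)]
    at h2
  linarith

/-- `v` is a nonnegative function on the plane, with gradient bounded by `c`, and `Y = a ∇v` has
nonnegative divergence for a conductivity `a` with values in `[m⁻², 1]`. -/
structure IsSubsolutionPair (m c : ℝ) (v : E2 → ℝ) (Y : Fin 2 → E2 → ℝ) : Prop where
  contDiff : ContDiff ℝ 1 v
  contDiff_field : ∀ i, ContDiff ℝ 1 (Y i)
  nonneg : ∀ x, 0 ≤ v x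
  div_nonneg : ∀ x, 0 ≤ ∑ i, pderivE (Y i) i x
  conductivity : ∀ x, ∃ a, 1 ≤ a * m ^ 2 ∧ a ≤ 1 ∧ ∀ i, Y i x = a * pderivE v i x
  grad_le : ∀ x, ∑ i, pderivE v i x ^ 2 ≤ c ^ 2

def circleEnergy (v : E2 → ℝ) (Y : Fin 2 → E2 → ℝ) (r : ℝ) : ℝ :=
  ∫ t in (0)..(2 * π), ∑ i, Y i (r • radialDir t) * pderivE v i (r • radialDir t)

def diskEnergy (v : E2 → ℝ) (Y : Fin 2 → E2 → ℝ) (r : ℝ) : ℝ :=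
  ∫ s in (0)..r, s * circleEnergy v Y s

def circleFlux (v : E2 → ℝ) (Y : Fin 2 → E2 → ℝ) (r : ℝ) : ℝ :=
  ∫ t in (0)..(2 * π), r * (v (r • radialDir t) * Y 0 (r • radialDir t) * cos t +
    v (r • radialDir t) * Y 1 (r • radialDir t) * sin t)

namespace IsSubsolutionPair

variable {m c : ℝ} {v : E2 → ℝ} {Y : Fin 2 → E2 → ℝ}

theorem density_nonneg (h : IsSubsolutionPair m c v Y) (x : E2) :
    0 ≤ ∑ i, Y i x * pderivE v i x := by
  obtain ⟨a, ha, -, hY⟩ := h.conductivity x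
  have : 0 ≤ a := by nlinarith [sq_nonneg m]
  refine Finset.sum_nonneg fun i _ => ?_
  rw [hY, mul_assoc]
  exact mul_nonneg this (mul_self_nonneg _)

theorem density_le (h : IsSubsolutionPair m c v Y) (x : E2) :
    ∑ i, Y i x * pderivE v i x ≤ c ^ 2 := by
  obtain ⟨a, ha, ha1, hY⟩ := h.conductivity x
  refine le_trans (Finset.sum_le_sum fun i _ => ?_) (h.grad_le x)
  rw [hY]
  nlinarith [sq_nonneg (pderivE v i x)]

theorem continuous_density (h : IsSubsolutionPair m c v Y) :
    Continuous fun x => ∑ i, Y i x * pderivE v i x := by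
  have := fun i => (h.contDiff_field i).continuous
  have := fun i => continuous_pderivE h.contDiff i
  fun_prop

theorem continuous_density_circle (h : IsSubsolutionPair m c v Y) (r : ℝ) :
    Continuous fun t => ∑ i, Y i (r • radialDir t) * pderivE v i (r • radialDir t) :=
  h.continuous_density.comp (f := fun t => r • radialDir t) (by fun_prop)

theorem continuous_circleEnergy (h : IsSubsolutionPair m c v Y) :
    Continuous (circleEnergy v Y) := by
  refine intervalIntegral.continuous_parametric_intervalIntegral_of_continuous' ?_ _ _
  exact h.continuous_density.comp (f := fun p : ℝ × ℝ => p.1 • radialDir p.2) (by fun_prop)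

theorem circleEnergy_nonneg (h : IsSubsolutionPair m c v Y) (r : ℝ) : 0 ≤ circleEnergy v Y r :=
  intervalIntegral.integral_nonneg Real.two_pi_pos.le fun _ _ => h.density_nonneg _

theorem circleEnergy_le (h : IsSubsolutionPair m c v Y) (r : ℝ) :
    circleEnergy v Y r ≤ 2 * π * c ^ 2 := by
  calc circleEnergy v Y r ≤ ∫ _ in (0)..(2 * π), c ^ 2 :=
        intervalIntegral.integral_mono_on Real.two_pi_pos.le
          ((h.continuous_density_circle r).intervalIntegrable _ _) intervalIntegrable_const
          fun _ _ => h.density_le _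
    _ = 2 * π * c ^ 2 := by simp

theorem hasDerivAt_diskEnergy (h : IsSubsolutionPair m c v Y) (r : ℝ) :
    HasDerivAt (diskEnergy v Y) (r * circleEnergy v Y r) r :=
  have hc : Continuous fun s => s * circleEnergy v Y s := continuous_id.mul h.continuous_circleEnergy
  intervalIntegral.integral_hasDerivAt_right (hc.intervalIntegrable _ _)
    hc.stronglyMeasurable.stronglyMeasurableAtFilter hc.continuousAt

theorem diskEnergy_le (h : IsSubsolutionPair m c v Y) {r : ℝ} (hr : 0 ≤ r) :
    diskEnergy v Y r ≤ π * c ^ 2 * r ^ 2 := by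
  have hc : Continuous fun s => s * circleEnergy v Y s := continuous_id.mul h.continuous_circleEnergy
  calc diskEnergy v Y r ≤ ∫ s in (0)..r, s * (2 * π * c ^ 2) :=
        intervalIntegral.integral_mono_on hr (hc.intervalIntegrable _ _)
          ((show Continuous fun s : ℝ => s * (2 * π * c ^ 2) by fun_prop).intervalIntegrable _ _)
          fun s hs => mul_le_mul_of_nonneg_left (h.circleEnergy_le s) hs.1
    _ = π * c ^ 2 * r ^ 2 := by
        rw [intervalIntegral.integral_mul_const, integral_id]; ring

theorem diskEnergy_le_circleFlux (h : IsSubsolutionPair m c v Y) {r : ℝ} (hr : 0 ≤ r) :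
    diskEnergy v Y r ≤ circleFlux v Y r := by
  have hX : ∀ i, ContDiff ℝ 1 fun x => v x * Y i x := fun i => h.contDiff.mul (h.contDiff_field i)
  have hpd : ∀ i x, pderivE (fun x => v x * Y i x) i x =
      v x * pderivE (Y i) i x + Y i x * pderivE v i x := fun i x => by
    simp only [pderivE]
    rw [fderiv_fun_mul (h.contDiff.differentiable one_ne_zero x)
      ((h.contDiff_field i).differentiable one_ne_zero x)]
    simp
  have hd := fun s => (hasDerivAt_integral_radial_flux hX s).sub (h.hasDerivAt_diskEnergy s)
  have hmono : MonotoneOn (fun s => circleFlux v Y s - diskEnergy v Y s) (Set.Ici 0) := by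
    refine monotoneOn_of_deriv_nonneg (convex_Ici 0)
      (fun s _ => (hd s).continuousAt.continuousWithinAt)
      (fun s _ => (hd s).differentiableAt.differentiableWithinAt) fun s hs => ?_
    rw [interior_Ici, Set.mem_Ioi] at hs
    refine (le_of_le_of_eq ?_ (hd s).deriv.symm)
    rw [sub_nonneg, circleEnergy, ← intervalIntegral.integral_const_mul]
    have hcp := fun i => continuous_pderivE (hX i) i
    refine intervalIntegral.integral_mono_on Real.two_pi_pos.le
      ((continuous_const.mul (h.continuous_density_circle s)).intervalIntegrable _ _)
      ((show Continuous fun t => s * ∑ i, pderivE (fun x => v x * Y i x) i (s • radialDir t)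
        by fun_prop).intervalIntegrable _ _) fun t _ => ?_
    refine mul_le_mul_of_nonneg_left ?_ hs.le
    simp only [hpd, Finset.sum_add_distrib, ← Finset.mul_sum]
    have := mul_nonneg (h.nonneg (s • radialDir t)) (h.div_nonneg (s • radialDir t))
    linarith
  have := hmono (Set.self_mem_Ici) hr hr
  simp only [circleFlux, diskEnergy] at this ⊢
  simp only [zero_mul, intervalIntegral.integral_zero, intervalIntegral.integral_same] at this
  linarith

theorem circleFlux_le (h : IsSubsolutionPair m c v Y) (hm : 0 < m) {r l : ℝ}
    (hl : 0 < l) (hzero : ∃ a, v (r • radialDir a) = 0)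
    (hl3 : l * posLength (fun t => v (r • radialDir t)) 0 (2 * π) ≤ 3) :
    circleFlux v Y r ≤ r ^ 2 * m / (2 * l) * circleEnergy v Y r := by
  obtain ⟨a, ha⟩ := hzero
  have hvc := h.contDiff.continuous
  have hYc := fun i => (h.contDiff_field i).continuous
  have hp := fun i => continuous_pderivE h.contDiff i
  set f : ℝ → ℝ := fun t => v (r • radialDir t) with hf
  set f' : ℝ → ℝ := fun t => r * (-sin t * pderivE v 0 (r • radialDir t) +
    cos t * pderivE v 1 (r • radialDir t)) with hf'
  have hfc : Continuous f := by fun_prop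
  have hf'c : Continuous f' := by fun_prop
  have hW := wirtinger_posLength (f := f) (f' := f') Real.two_pi_pos.le
    (fun t => hasDerivAt_smul_radialDir_right h.contDiff r t) hf'c (fun t => h.nonneg _)
    (fun t => by simp [hf, radialDir_periodic t]) ha hl.le hl3
  have key : circleFlux v Y r ≤ ∫ t in (0)..(2 * π),
      (r ^ 2 * m / (2 * l) * (∑ i, Y i (r • radialDir t) * pderivE v i (r • radialDir t)) -
        1 / (2 * l * m) * (f' t ^ 2 - l ^ 2 * f t ^ 2)) := by
    refine intervalIntegral.integral_mono_on Real.two_pi_pos.le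
      (Continuous.intervalIntegrable (by fun_prop) _ _)
      (Continuous.intervalIntegrable (by fun_prop) _ _) fun t _ => ?_
    obtain ⟨b, hb, hb1, hY⟩ := h.conductivity (r • radialDir t)
    simp only [hf', hY, Fin.sum_univ_two]
    change r * (f t * _ * _ + f t * _ * _) ≤ _
    generalize f t = w
    generalize pderivE v 0 (r • radialDir t) = p
    generalize pderivE v 1 (r • radialDir t) = q
    have hcs := Real.sin_sq_add_cos_sq t
    have hb0 : 0 ≤ b := by nlinarith [sq_nonneg m]
    have e : r ^ 2 * m / (2 * l) * (b * p * p + b * q * q) -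
        1 / (2 * l * m) * ((r * (-sin t * p + cos t * q)) ^ 2 - l ^ 2 * w ^ 2) -
        r * (w * (b * p) * cos t + w * (b * q) * sin t) =
        1 / (2 * l * m) * (b * (r * m * (cos t * p + sin t * q) - l * w) ^ 2 +
          (1 - b) * l ^ 2 * w ^ 2 + (b * m ^ 2 - 1) * (r * (-sin t * p + cos t * q)) ^ 2) := by
      have e1 : p * p + q * q = (cos t * p + sin t * q) ^ 2 + (-sin t * p + cos t * q) ^ 2 := by
        linear_combination (-p ^ 2 - q ^ 2) * hcs
      rw [show b * p * p + b * q * q = b * (p * p + q * q) by ring, e1]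
      field_simp
      ring
    have : 0 ≤ 1 / (2 * l * m) * (b * (r * m * (cos t * p + sin t * q) - l * w) ^ 2 +
          (1 - b) * l ^ 2 * w ^ 2 + (b * m ^ 2 - 1) * (r * (-sin t * p + cos t * q)) ^ 2) := by
      have h1 : 0 ≤ 1 - b := by linarith
      have h2 : 0 ≤ b * m ^ 2 - 1 := by linarith
      positivity
    linarith
  refine key.trans ?_
  rw [intervalIntegral.integral_sub (Continuous.intervalIntegrable (by fun_prop) _ _)
      (Continuous.intervalIntegrable (by fun_prop) _ _),
    intervalIntegral.integral_const_mul, intervalIntegral.integral_const_mul,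
    intervalIntegral.integral_sub (Continuous.intervalIntegrable (by fun_prop) _ _)
      (Continuous.intervalIntegrable (by fun_prop) _ _), intervalIntegral.integral_const_mul]
  have : 0 ≤ 1 / (2 * l * m) * ((∫ t in (0)..(2 * π), f' t ^ 2) -
      l ^ 2 * ∫ t in (0)..(2 * π), f t ^ 2) :=
    mul_nonneg (by positivity) (sub_nonneg.2 hW)
  change _ ≤ r ^ 2 * m / (2 * l) * ∫ t in (0)..(2 * π), _
  linarith

/-- Nonconstant subsolutions have positive energy on all large disks. -/
theorem exists_forall_diskEnergy_pos (h : IsSubsolutionPair m c v Y)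
    (hne : ∃ x y, v x ≠ v y) : ∃ R, 0 < R ∧ ∀ r, R < r → 0 < diskEnergy v Y r := by
  obtain ⟨x, hx⟩ : ∃ x, fderiv ℝ v x ≠ 0 := by
    by_contra! hcon
    obtain ⟨x, y, hxy⟩ := hne
    exact hxy (is_const_of_fderiv_eq_zero (h.contDiff.differentiable one_ne_zero) hcon x y)
  have hopen : IsOpen {x | fderiv ℝ v x ≠ 0} :=
    isOpen_ne_fun (h.contDiff.continuous_fderiv one_ne_zero) continuous_const
  obtain ⟨y, hy, hy0⟩ := (dense_compl_singleton (0 : E2)).inter_open_nonempty _ hopen ⟨x, hx⟩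
  obtain ⟨s, t, hs, ht0, ht, rfl⟩ := exists_eq_smul_radialDir y
  have hs0 : 0 < s := hs.lt_of_ne fun h0 => hy0 (by simp [← h0])
  have hdens : 0 < ∑ i, Y i (s • radialDir t) * pderivE v i (s • radialDir t) := by
    obtain ⟨a, ha, -, hY⟩ := h.conductivity (s • radialDir t)
    refine (h.density_nonneg _).lt_of_ne fun h0 => hy ?_
    have ha0 : 0 < a := by
      by_contra! hcon
      nlinarith [sq_nonneg m]
    simp only [hY, Fin.sum_univ_two] at h0
    have h1 : pderivE v 0 (s • radialDir t) = 0 := by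
      by_contra hh
      nlinarith [mul_pos ha0 (pow_pos (abs_pos.2 hh) 2), sq_abs (pderivE v 0 (s • radialDir t)),
        mul_nonneg ha0.le (mul_self_nonneg (pderivE v 1 (s • radialDir t)))]
    have h2 : pderivE v 1 (s • radialDir t) = 0 := by
      by_contra hh
      nlinarith [mul_pos ha0 (pow_pos (abs_pos.2 hh) 2), sq_abs (pderivE v 1 (s • radialDir t)),
        mul_nonneg ha0.le (mul_self_nonneg (pderivE v 0 (s • radialDir t)))]
    ext z
    have hz : z = z 0 • EuclideanSpace.single 0 1 + z 1 • EuclideanSpace.single 1 1 := by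
      ext i; fin_cases i <;> simp
    rw [pderivE] at h1 h2
    rw [hz]
    simp [h1, h2]
  have hcirc : 0 < circleEnergy v Y s :=
    intervalIntegral.integral_pos Real.two_pi_pos (h.continuous_density_circle s).continuousOn
      (fun _ _ => h.density_nonneg _) ⟨t, ⟨ht0, ht.le⟩, hdens⟩
  refine ⟨s, hs0, fun r hr => ?_⟩
  exact intervalIntegral.integral_pos (hs0.trans hr)
    (continuous_id.mul h.continuous_circleEnergy).continuousOn
    (fun q hq => mul_nonneg hq.1.le (h.circleEnergy_nonneg q)) ⟨s, ⟨hs, hr.le⟩, mul_pos hs0 hcirc⟩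

end IsSubsolutionPair

theorem posLength_nonneg (f : ℝ → ℝ) {a b : ℝ} (hab : a ≤ b) : 0 ≤ posLength f a b :=
  intervalIntegral.integral_nonneg hab fun t _ =>
    Set.indicator_nonneg (fun _ _ => zero_le_one) t

theorem sum_posLength_le {ι : Type*} [Fintype ι] {f : ι → ℝ → ℝ} (hf : ∀ i, Continuous (f i))
    (hdisj : ∀ i j, i ≠ j → ∀ t, f i t = 0 ∨ f j t = 0) {a b : ℝ} (hab : a ≤ b) :
    ∑ i, posLength (f i) a b ≤ b - a := by
  classical
  have hint := fun i => intervalIntegrable_indicator_pos (hf i) a b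
  have hsum : IntervalIntegrable
      (fun t => ∑ i, Set.indicator {t | 0 < f i t} (fun _ => (1 : ℝ)) t) volume a b := by
    simpa only [Finset.sum_fn] using IntervalIntegrable.sum Finset.univ fun i _ => hint i
  simp only [posLength]
  rw [← intervalIntegral.integral_finsetSum fun i _ => hint i]
  have h1 : ∫ _ in a..b, (1 : ℝ) = b - a := by simp
  rw [← h1]
  refine intervalIntegral.integral_mono_on hab hsum
    intervalIntegrable_const fun t _ => ?_
  by_cases h : ∃ i, 0 < f i t
  · obtain ⟨i, hi⟩ := h
    rw [Finset.sum_eq_single i]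
    · exact Set.indicator_le_self' (fun _ _ => zero_le_one) t
    · intro j _ hj
      have : f j t = 0 := (hdisj j i hj t).resolve_right hi.ne'
      simp [this]
    · simp
  · push Not at h
    rw [Finset.sum_eq_zero]
    · exact zero_le_one
    · intro i _
      simp [h i]

/-- A lower bound for the logarithmic derivative of the energy, in tangent-line form. -/
theorem IsSubsolutionPair.le_logDeriv_diskEnergy {m c b r : ℝ} {v : E2 → ℝ}
    {Y : Fin 2 → E2 → ℝ} (h : IsSubsolutionPair m c v Y) (hm : 0 < m) (hr : 0 < r) (hb : 0 < b)
    (hJ : 0 < diskEnergy v Y r) (hzero : ∃ a, v (r • radialDir a) = 0) :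
    6 / (r * m) * (2 / b - posLength (fun t => v (r • radialDir t)) 0 (2 * π) / b ^ 2) ≤
      r * circleEnergy v Y r / diskEnergy v Y r := by
  have hle : ∀ l, 0 < l → l * posLength (fun t => v (r • radialDir t)) 0 (2 * π) ≤ 3 →
      diskEnergy v Y r ≤ r ^ 2 * m / (2 * l) * circleEnergy v Y r := fun l hl hl3 =>
    (h.diskEnergy_le_circleFlux hr.le).trans (h.circleFlux_le hm hl hzero hl3)
  have hth := posLength_nonneg (fun t => v (r • radialDir t)) Real.two_pi_pos.le
  have hE := h.circleEnergy_nonneg r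
  generalize posLength (fun t => v (r • radialDir t)) 0 (2 * π) = q at *
  generalize circleEnergy v Y r = E at *
  generalize diskEnergy v Y r = J at *
  have hq : 0 < q := by
    refine hth.lt_of_ne fun h0 => ?_
    have h1 := hle ((r ^ 2 * m * E + 1) / J) (by positivity) (by rw [← h0]; simp)
    have h2 : r ^ 2 * m / (2 * ((r ^ 2 * m * E + 1) / J)) * E =
        J * (r ^ 2 * m * E / (2 * (r ^ 2 * m * E + 1))) := by
      field_simp
    have h3 : r ^ 2 * m * E / (2 * (r ^ 2 * m * E + 1)) < 1 := by
      have : 0 ≤ r ^ 2 * m * E := by positivity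
      rw [div_lt_one (by positivity)]
      linarith
    nlinarith
  have h1 := hle (3 / q) (by positivity) (by field_simp; exact le_rfl)
  have h2 : 6 / (r * m) * (1 / q) ≤ r * E / J := by
    rw [le_div_iff₀ hJ]
    calc 6 / (r * m) * (1 / q) * J
        ≤ 6 / (r * m) * (1 / q) * (r ^ 2 * m / (2 * (3 / q)) * E) := by gcongr
      _ = r * E := by field_simp; ring
  refine le_trans ?_ h2
  have h3 : 1 / q - (2 / b - q / b ^ 2) = (q - b) ^ 2 / (q * b ^ 2) := by
    field_simp
    ring
  have h4 : 0 ≤ (q - b) ^ 2 / (q * b ^ 2) := by positivity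
  gcongr
  linarith

/-- A family of disjointly supported subsolutions has at most `2πm/3` members. -/
theorem card_le_of_isSubsolutionPair {k : ℕ} (hk : 2 ≤ k) {m c : ℝ} (hm : 0 < m)
    {v : Fin k → E2 → ℝ} {Y : Fin k → Fin 2 → E2 → ℝ}
    (h : ∀ i, IsSubsolutionPair m c (v i) (Y i))
    (hdisj : ∀ i j, i ≠ j → ∀ x, v i x = 0 ∨ v j x = 0) (hne : ∀ i, ∃ x, v i x ≠ 0) :
    (k : ℝ) ≤ 2 * π / 3 * m := by
  have : Nontrivial (Fin k) := Fin.nontrivial_iff_two_le.2 hk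
  have hkpos : (0 : ℝ) < k := by exact_mod_cast (by lia : 0 < k)
  have hpi := Real.pi_pos
  have hnc : ∀ i, ∃ x y, v i x ≠ v i y := fun i => by
    obtain ⟨j, hj⟩ := exists_ne i
    obtain ⟨x, hx⟩ := hne i
    obtain ⟨y, hy⟩ := hne j
    exact ⟨x, y, by rwa [(hdisj j i hj y).resolve_left hy]⟩
  choose R hR hRJ using fun i => (h i).exists_forall_diskEnergy_pos (hnc i)
  obtain ⟨R₀, hR₀, hJpos⟩ : ∃ R₀, 0 < R₀ ∧ ∀ r, R₀ ≤ r → ∀ i, 0 < diskEnergy (v i) (Y i) r := by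
    refine ⟨∑ i, R i + 1, add_pos_of_nonneg_of_pos
      (Finset.sum_nonneg fun i _ => (hR i).le) one_pos, fun r hr i => hRJ i r ?_⟩
    have := Finset.single_le_sum (fun j _ => (hR j).le) (Finset.mem_univ i)
    linarith
  set J : Fin k → ℝ → ℝ := fun i => diskEnergy (v i) (Y i) with hJ
  set L' : ℝ → ℝ := fun r => ∑ i, r * circleEnergy (v i) (Y i) r / J i r with hL'
  set α : ℝ := 3 * k ^ 2 / (π * m) with hα
  have hzero : ∀ r, R₀ ≤ r → ∀ i, ∃ a, v i (r • radialDir a) = 0 := fun r hr i => by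
    obtain ⟨j, hj⟩ := exists_ne i
    by_contra! hcon
    have hvj : ∀ a, v j (r • radialDir a) = 0 := fun a =>
      (hdisj j i hj _).resolve_right (hcon a)
    have h1 := (h j).diskEnergy_le_circleFlux (hR₀.le.trans hr)
    have h2 : circleFlux (v j) (Y j) r = 0 := by simp [circleFlux, hvj]
    linarith [hJpos r hr j]
  have hL'_ge : ∀ r, R₀ ≤ r → α / r ≤ L' r := fun r hr => by
    have hr0 : 0 < r := hR₀.trans_le hr
    have hb : 0 < 2 * π / k := by positivity
    have h1 := Finset.sum_le_sum fun i (_ : i ∈ Finset.univ) =>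
      (h i).le_logDeriv_diskEnergy hm hr0 hb (hJpos r hr i) (hzero r hr i)
    refine le_trans ?_ h1
    have h2 := sum_posLength_le (f := fun i t => v i (r • radialDir t))
      (fun i => (h i).contDiff.continuous.comp (by fun_prop))
      (fun i j hij t => hdisj i j hij _) Real.two_pi_pos.le
    rw [← Finset.mul_sum, Finset.sum_sub_distrib, Finset.sum_const, ← Finset.sum_div]
    simp only [ Finset.card_univ, Fintype.card_fin, nsmul_eq_mul]
    calc α / r = 6 / (r * m) * (k * (2 / (2 * π / k)) - (2 * π - 0) / (2 * π / k) ^ 2) := by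
          simp only [hα]
          field_simp
          ring
      _ ≤ _ := by gcongr
  have hd : ∀ r, R₀ ≤ r → HasDerivAt (fun s => ∑ i, Real.log (J i s) - α * Real.log s)
      (L' r - α * r⁻¹) r := fun r hr =>
    (HasDerivAt.fun_sum fun i _ =>
      ((h i).hasDerivAt_diskEnergy r).log (hJpos r hr i).ne').sub
      ((Real.hasDerivAt_log (hR₀.trans_le hr).ne').const_mul α)
  have hmono : MonotoneOn (fun s => ∑ i, Real.log (J i s) - α * Real.log s) (Set.Ici R₀) := by
    refine monotoneOn_of_deriv_nonneg (convex_Ici R₀)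
      (fun s hs => (hd s hs).continuousAt.continuousWithinAt)
      (fun s hs => (hd s (interior_subset hs)).differentiableAt.differentiableWithinAt)
      fun s hs => ?_
    rw [(hd s (interior_subset hs)).deriv, sub_nonneg, ← div_eq_mul_inv]
    exact hL'_ge s (interior_subset hs)
  have hJle : ∀ r, R₀ ≤ r → ∀ i, Real.log (J i r) ≤ Real.log (π * c ^ 2) + 2 * Real.log r :=
      fun r hr i => by
    have hr0 : 0 < r := hR₀.trans_le hr
    have h1 := (h i).diskEnergy_le hr0.le
    have h2 : π * c ^ 2 ≠ 0 := fun h0 => by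
      rw [h0, zero_mul] at h1
      exact h1.not_gt (hJpos r hr i)
    calc Real.log (J i r) ≤ Real.log (π * c ^ 2 * r ^ 2) := Real.log_le_log (hJpos r hr i) h1
      _ = _ := by rw [Real.log_mul h2 (by positivity), Real.log_pow]; norm_num
  have hαk : α ≤ 2 * k := by
    by_contra! hcon
    set C : ℝ := k * Real.log (π * c ^ 2) - (∑ i, Real.log (J i R₀) - α * Real.log R₀) with hC
    obtain ⟨r, hrlog, hr⟩ := ((Real.tendsto_log_atTop.eventually_gt_atTop
      (C / (α - 2 * k))).and (Filter.eventually_ge_atTop R₀)).exists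
    have h1 := hmono Set.self_mem_Ici hr hr
    have h2 := Finset.sum_le_sum fun i (_ : i ∈ Finset.univ) => hJle r hr i
    simp only [Finset.sum_const, Finset.card_univ, Fintype.card_fin, nsmul_eq_mul] at h2
    rw [div_lt_iff₀ (by linarith)] at hrlog
    simp only at h1
    linarith
  rw [hα, div_le_iff₀ (by positivity)] at hαk
  have : k * (3 * k) ≤ k * (2 * π * m) := by linarith
  have := le_of_mul_le_mul_left this hkpos
  linarith

theorem exists_smooth_truncation : ∃ g : ℝ → ℝ, ContDiff ℝ (⊤ : ℕ∞) g ∧ (∀ t ≤ 0, g t = 0) ∧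
    (∀ t, 0 < t → 0 < g t) ∧ (∀ t, 0 ≤ deriv g t) ∧ (∀ t, deriv g t ≤ 1) ∧
    ∀ t, 0 ≤ deriv (deriv g) t := by
  have hc := Real.smoothTransition.continuous
  set g : ℝ → ℝ := fun t => ∫ s in (0)..t, Real.smoothTransition s with hg
  have hd : ∀ t, HasDerivAt g (Real.smoothTransition t) t := fun t =>
    intervalIntegral.integral_hasDerivAt_right (hc.intervalIntegrable _ _)
      hc.stronglyMeasurable.stronglyMeasurableAtFilter hc.continuousAt
  have hderiv : deriv g = Real.smoothTransition := funext fun t => (hd t).deriv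
  refine ⟨g, ?_, fun t ht => ?_, fun t ht => ?_, ?_, ?_, ?_⟩
  · rw [contDiff_infty_iff_deriv, hderiv]
    exact ⟨fun t => (hd t).differentiableAt, Real.smoothTransition.contDiff⟩
  · have h : ∫ s in (0)..t, Real.smoothTransition s = ∫ _ in (0)..t, (0 : ℝ) :=
      intervalIntegral.integral_congr fun s hs => by
        rw [Set.uIcc_of_ge ht] at hs
        exact Real.smoothTransition.zero_of_nonpos hs.2
    simpa using h
  · exact intervalIntegral.integral_pos ht hc.continuousOn
      (fun s _ => Real.smoothTransition.nonneg s)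
      ⟨t, ⟨ht.le, le_rfl⟩, Real.smoothTransition.pos_of_pos ht⟩
  · simpa [hderiv] using Real.smoothTransition.nonneg
  · simpa [hderiv] using Real.smoothTransition.le_one
  · rw [hderiv]
    exact fun t => Real.smoothTransition.monotone.deriv_nonneg

theorem contDiff_of_contDiffOn_of_isClosed {f : E2 → ℝ} {Ω K : Set E2} {n : WithTop ℕ∞}
    (hΩ : IsOpen Ω) (hK : IsClosed K) (hKΩ : K ⊆ Ω) (hf : ContDiffOn ℝ n f Ω)
    (hf0 : ∀ x ∉ K, f x = 0) : ContDiff ℝ n f := by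
  refine contDiff_iff_contDiffAt.2 fun x => ?_
  by_cases hx : x ∈ Ω
  · exact hf.contDiffAt (hΩ.mem_nhds hx)
  · refine (contDiffAt_const (c := (0 : ℝ))).congr_of_eventuallyEq ?_
    filter_upwards [hK.isOpen_compl.mem_nhds fun h => hx (hKΩ h)] with y hy using hf0 y hy

theorem pderivE_eq_gradient {u : E2 → ℝ} (x : E2) (i : Fin 2) :
    pderivE u i x = gradient u x i := by
  have h : inner ℝ (gradient u x) (EuclideanSpace.single i 1) = pderivE u i x :=
    inner_gradient_left
  rw [← h, EuclideanSpace.inner_single_right]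
  simp

theorem pderivE_congr {f g : E2 → ℝ} {x : E2} (h : f =ᶠ[nhds x] g) (i : Fin 2) :
    pderivE f i x = pderivE g i x := by
  rw [pderivE, pderivE, h.fderiv_eq]

/-- A smooth convex truncation of a supported minimal graph is a global subsolution. -/
theorem exists_isSubsolutionPair {Ω : Set E2} {u : E2 → ℝ} {c : ℝ}
    (hopen : IsOpen Ω) (hsmooth : ContDiffOn ℝ (⊤ : ℕ∞) u Ω)
    (hmse : ∀ x ∈ Ω, msDiv u x = 0) (hnonneg : ∀ x ∈ Ω, 0 ≤ u x)
    (hcont : ContinuousOn u (closure Ω)) (hbdry : ∀ x ∈ frontier Ω, u x = 0)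
    (hnontrivial : ∃ x ∈ Ω, u x ≠ 0) (hgrad : ∀ x ∈ Ω, ‖gradient u x‖ ≤ c) :
    ∃ v Y, IsSubsolutionPair √(√(1 + c ^ 2)) c v Y ∧ (∀ x ∉ Ω, v x = 0) ∧ ∃ x, v x ≠ 0 := by
  obtain ⟨g, hg, hg0, hgpos, hg'0, hg'1, hg''⟩ := exists_smooth_truncation
  have hg' : ContDiff ℝ (⊤ : ℕ∞) (deriv g) := (contDiff_infty_iff_deriv.1 hg).2
  have hg'zero : ∀ t ≤ 0, deriv g t = 0 := fun t ht => by
    have hd : ∀ t, DifferentiableAt ℝ g t := (contDiff_infty_iff_deriv.1 hg).1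
    have h1 := (hd t).hasDerivAt.hasDerivWithinAt (s := Set.Iic t)
    have h2 : HasDerivWithinAt g 0 (Set.Iic t) t :=
      (hasDerivWithinAt_const t _ (0 : ℝ)).congr (fun s hs => hg0 s (hs.trans ht)) (hg0 t ht)
    exact (uniqueDiffWithinAt_Iic t).eq_deriv _ h1 h2
  obtain ⟨x₀, hx₀, hux₀⟩ := hnontrivial
  have hux₀' : 0 < u x₀ := (hnonneg x₀ hx₀).lt_of_ne hux₀.symm
  set ε : ℝ := u x₀ / 2 with hε
  have hεpos : 0 < ε := by positivity
  set K : Set E2 := closure Ω ∩ u ⁻¹' Set.Ici ε with hK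
  have hKc : IsClosed K := hcont.preimage_isClosed_of_isClosed isClosed_closure isClosed_Ici
  have hKΩ : K ⊆ Ω := fun x hx => by
    by_contra hxΩ
    have : x ∈ frontier Ω := by rw [hopen.frontier_eq]; exact ⟨hx.1, hxΩ⟩
    have h1 : ε ≤ u x := hx.2
    linarith [hbdry x this]
  set a : E2 → ℝ := fun y => (√(1 + ‖gradient u y‖ ^ 2))⁻¹ with ha
  set W : Fin 2 → E2 → ℝ := fun i y => a y * gradient u y i with hW
  have hgradsm : ContDiffOn ℝ (⊤ : ℕ∞) (gradient u) Ω :=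
    (InnerProductSpace.toDual ℝ E2).symm.contDiff.comp_contDiffOn
      (hsmooth.fderiv_of_isOpen hopen (by simp))
  have hWsm : ∀ i, ContDiffOn ℝ (⊤ : ℕ∞) (W i) Ω := fun i => by
    refine ContDiffOn.mul (ContDiffOn.inv (ContDiffOn.sqrt
      (contDiffOn_const.add (hgradsm.norm_sq ℝ)) fun x _ => by positivity)
      fun x _ => by positivity) ?_
    exact (EuclideanSpace.proj (𝕜 := ℝ) i).contDiff.comp_contDiffOn hgradsm
  have husub : ContDiffOn ℝ (⊤ : ℕ∞) (fun y => u y - ε) Ω := hsmooth.sub contDiffOn_const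
  have hlow : ∀ x ∈ Ω, x ∉ K → u x - ε ≤ 0 := fun x hx hxK => by
    by_contra! hcon
    exact hxK ⟨subset_closure hx, by simp only [Set.mem_preimage, Set.mem_Ici]; linarith⟩
  set v : E2 → ℝ := Ω.indicator fun y => g (u y - ε) with hv
  set Y : Fin 2 → E2 → ℝ := fun i => Ω.indicator fun y => deriv g (u y - ε) * W i y with hY
  have hvΩ : ∀ x ∈ Ω, v =ᶠ[nhds x] fun y => g (u y - ε) := fun x hx => by
    filter_upwards [hopen.mem_nhds hx] with y hy using Set.indicator_of_mem hy _
  have hYΩ : ∀ i, ∀ x ∈ Ω, Y i =ᶠ[nhds x] fun y => deriv g (u y - ε) * W i y := fun i x hx => by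
    filter_upwards [hopen.mem_nhds hx] with y hy using Set.indicator_of_mem hy _
  have hvK : ∀ x ∉ K, v x = 0 := fun x hx => by
    by_cases hxΩ : x ∈ Ω
    · simp [hv, hxΩ, hg0 _ (hlow x hxΩ hx)]
    · simp [hv, hxΩ]
  have hYK : ∀ i, ∀ x ∉ K, Y i x = 0 := fun i x hx => by
    by_cases hxΩ : x ∈ Ω
    · simp [hY, hxΩ, hg'zero _ (hlow x hxΩ hx)]
    · simp [hY, hxΩ]
  have hv0 : ∀ x ∉ Ω, ∀ i, pderivE v i x = 0 := fun x hx i => by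
    have : v =ᶠ[nhds x] fun _ => 0 := by
      filter_upwards [hKc.isOpen_compl.mem_nhds fun h => hx (hKΩ h)] with y hy using hvK y hy
    rw [pderivE_congr this]
    simp [pderivE]
  have hY0 : ∀ x ∉ Ω, ∀ i, pderivE (Y i) i x = 0 := fun x hx i => by
    have : Y i =ᶠ[nhds x] fun _ => 0 := by
      filter_upwards [hKc.isOpen_compl.mem_nhds fun h => hx (hKΩ h)] with y hy using hYK i y hy
    rw [pderivE_congr this]
    simp [pderivE]
  have hud : ∀ x ∈ Ω, HasFDerivAt u (fderiv ℝ u x) x := fun x hx =>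
    ((hsmooth.contDiffAt (hopen.mem_nhds hx)).differentiableAt (by simp)).hasFDerivAt
  have hpv : ∀ x ∈ Ω, ∀ i, pderivE v i x = deriv g (u x - ε) * gradient u x i := fun x hx i => by
    have h1 := (((contDiff_infty_iff_deriv.1 hg).1 (u x - ε)).hasDerivAt).comp_hasFDerivAt x
      ((hud x hx).sub_const ε)
    have h2 : fderiv ℝ (fun y => g (u y - ε)) x = _ := h1.fderiv
    rw [pderivE_congr (hvΩ x hx), pderivE, h2, ← pderivE_eq_gradient]
    simp [pderivE]
  have hpY : ∀ x ∈ Ω, ∀ i, pderivE (Y i) i x =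
      deriv g (u x - ε) * pderivE (W i) i x +
        deriv (deriv g) (u x - ε) * a x * gradient u x i ^ 2 := fun x hx i => by
    have h1 := (((contDiff_infty_iff_deriv.1 hg').1 (u x - ε)).hasDerivAt).comp_hasFDerivAt x
      ((hud x hx).sub_const ε)
    have h2 := h1.mul (((hWsm i).contDiffAt (hopen.mem_nhds hx)).differentiableAt
      (by simp)).hasFDerivAt
    have h3 : fderiv ℝ (fun y => deriv g (u y - ε) * W i y) x = _ := h2.fderiv
    rw [pderivE_congr (hYΩ i x hx), pderivE, h3]
    simp only [Function.comp, add_apply, smul_apply,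
      smul_eq_mul]
    change _ * pderivE (W i) i x + W i x * (_ * pderivE u i x) = _
    rw [pderivE_eq_gradient (u := u)]
    simp only [show W i x = a x * gradient u x i from rfl]
    ring
  have ha0 : ∀ x, 0 ≤ a x := fun x => by positivity
  have hm : √(√(1 + c ^ 2)) ^ 2 = √(1 + c ^ 2) := Real.sq_sqrt (Real.sqrt_nonneg _)
  have hnorm : ∀ x, ∑ i, gradient u x i ^ 2 = ‖gradient u x‖ ^ 2 := fun x => by
    rw [EuclideanSpace.norm_sq_eq]
    simp
  refine ⟨v, Y, ⟨?_, fun i => ?_, fun x => ?_, fun x => ?_, fun x => ?_, fun x => ?_⟩,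
    fun x hx => hvK x fun h => hx (hKΩ h), x₀, ?_⟩
  · refine (contDiff_of_contDiffOn_of_isClosed hopen hKc hKΩ ?_ hvK).of_le
      (by exact_mod_cast le_top : (1 : WithTop ℕ∞) ≤ (⊤ : ℕ∞))
    exact (hg.comp_contDiffOn husub).congr fun x hx => Set.indicator_of_mem hx _
  · refine (contDiff_of_contDiffOn_of_isClosed hopen hKc hKΩ ?_ (hYK i)).of_le
      (by exact_mod_cast le_top : (1 : WithTop ℕ∞) ≤ (⊤ : ℕ∞))
    exact ((hg'.comp_contDiffOn husub).mul (hWsm i)).congr fun x hx => Set.indicator_of_mem hx _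
  · refine Set.indicator_nonneg (fun y _ => ?_) x
    rcases le_or_gt (u y - ε) 0 with h | h
    · exact (hg0 _ h).ge
    · exact (hgpos _ h).le
  · by_cases hx : x ∈ Ω
    · have h1 : ∑ i, pderivE (W i) i x = 0 := hmse x hx
      simp only [hpY x hx, Finset.sum_add_distrib, ← Finset.mul_sum, h1, hnorm, mul_zero, zero_add]
      exact mul_nonneg (mul_nonneg (hg'' _) (ha0 x)) (sq_nonneg _)
    · simp [hY0 x hx]
  · rw [hm]
    by_cases hx : x ∈ Ω
    · refine ⟨a x, ?_, inv_le_one_of_one_le₀ (Real.one_le_sqrt.2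
        (by linarith [sq_nonneg ‖gradient u x‖])), fun i => ?_⟩
      · rw [ha, ← div_eq_inv_mul, one_le_div (by positivity)]
        have := hgrad x hx
        gcongr
      · rw [hpv x hx, (hYΩ i x hx).eq_of_nhds, hW]
        ring
    · refine ⟨1, ?_, le_rfl, fun i => ?_⟩
      · rw [one_mul]
        exact Real.one_le_sqrt.2 (by linarith [sq_nonneg c])
      · rw [hv0 x hx, hYK i x fun h => hx (hKΩ h), mul_zero]
  · by_cases hx : x ∈ Ω
    · simp only [hpv x hx, mul_pow, ← Finset.mul_sum, hnorm]
      have h1 : ‖gradient u x‖ ^ 2 ≤ c ^ 2 := by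
        have := hgrad x hx
        gcongr
      have h2 : deriv g (u x - ε) ^ 2 ≤ 1 := pow_le_one₀ (hg'0 _) (hg'1 _)
      calc _ ≤ 1 * ‖gradient u x‖ ^ 2 := by gcongr
        _ ≤ c ^ 2 := by linarith
    · simp only [hv0 x hx]
      simp [sq_nonneg]
  · rw [hv, Set.indicator_of_mem hx₀]
    exact (hgpos _ (by rw [hε]; linarith)).ne'

/-- **Bound on the number of disjointly supported minimal graphs with bounded gradient.**
If `(Ω₁,u₁),…,(Ω_k,u_k)` are disjointly supported minimal graphs in `ℝ³` with
`|∇uᵢ| ≤ c` on `Ωᵢ` for all `i`, then `k ≤ 2√(1+c²)`. -/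
theorem disjoint_minimal_graphs_bounded_gradient
    (k : ℕ) (Ω : Fin k → Set E2) (u : Fin k → E2 → ℝ) (c : ℝ) (hc : 0 ≤ c)
    (hopen : ∀ i, IsOpen (Ω i))
    (hdisj : Pairwise fun i j => Disjoint (Ω i) (Ω j))
    (hsmooth : ∀ i, ContDiffOn ℝ (⊤ : ℕ∞) (u i) (Ω i))
    (hmse : ∀ i, ∀ x ∈ Ω i, msDiv (u i) x = 0)
    (hnonneg : ∀ i, ∀ x ∈ Ω i, 0 ≤ u i x)
    (hcont : ∀ i, ContinuousOn (u i) (closure (Ω i)))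
    (hbdry : ∀ i, ∀ x ∈ frontier (Ω i), u i x = 0)
    (hnontrivial : ∀ i, ∃ x ∈ Ω i, u i x ≠ 0)
    (hgrad : ∀ i, ∀ x ∈ Ω i, ‖gradient (u i) x‖ ≤ c) :
    (k : ℝ) ≤ 2 * Real.sqrt (1 + c ^ 2) := by
  choose v Y hvY hv0 hvne using fun i => exists_isSubsolutionPair (hopen i) (hsmooth i) (hmse i)
    (hnonneg i) (hcont i) (hbdry i) (hnontrivial i) (hgrad i)
  have hM : 1 ≤ √(1 + c ^ 2) := Real.one_le_sqrt.2 (by linarith [sq_nonneg c])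
  rcases lt_or_ge k 3 with hk | hk
  · have : (k : ℝ) ≤ 2 := by exact_mod_cast (by lia : k ≤ 2)
    linarith
  have hk3 : (3 : ℝ) ≤ k := by exact_mod_cast hk
  have hm : 1 ≤ √(√(1 + c ^ 2)) := Real.one_le_sqrt.2 hM
  have hsq : √(√(1 + c ^ 2)) ^ 2 = √(1 + c ^ 2) := Real.sq_sqrt (Real.sqrt_nonneg _)
  have h := card_le_of_isSubsolutionPair (by lia) (by linarith) hvY
    (fun i j hij x => by
      by_contra! hcon
      exact Set.disjoint_left.1 (hdisj hij) (by_contra fun h => hcon.1 (hv0 i x h))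
        (by_contra fun h => hcon.2 (hv0 j x h))) hvne
  rw [← hsq]
  have hpi := Real.pi_lt_d2
  nlinarith
end
end
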